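/- arXiv:2312.14341 — 7 statements merged into one kernel-verified Lean document; each statement's English description precedes it below -/
import Mathlib

section
/- Let O ⊆ ℝⁿ be an open set, f₁ : O → ℝ ∪ {+∞} and f₂ : O → ℝ two functions which are finite at a point x ∈ O with f₂(x) > 0. Suppose f₁ is continuous at x relative to dom f₁ and f₂ is calm at x, and set α₁ := f₁(x), α₂ := f₂(x). Then the Fréchet subdifferential of the quotient satisfies ∂̂(f₁/f₂)(x) = (1/f₂(x)²) · ∂̂(α₂ f₁ − α₁ f₂)(x), where the right-hand side is the set {v/f₂(x)² : v ∈ ∂̂(α₂ f₁ − α₁ f₂)(x)}. -/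
open Set Filter Topology Metric

open scoped RealInnerProductSpace

noncomputable section

namespace FracPaper

variable {E : Type*} [NormedAddCommGroup E] [InnerProductSpace ℝ E] [FiniteDimensional ℝ E]
variable {F : Type*} [NormedAddCommGroup F] [InnerProductSpace ℝ F] [FiniteDimensional ℝ F]
variable {G : Type*} [NormedAddCommGroup G] [InnerProductSpace ℝ G] [FiniteDimensional ℝ G]

/-- The effective domain of an `EReal`-valued function. -/
def edom (f : E → EReal) : Set E := {x | f x ≠ ⊤}

/-- `f` is proper: it takes values in `ℝ ∪ {+∞}` and is not identically `+∞`. -/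
def ProperFn (f : E → EReal) : Prop := (∀ x, f x ≠ ⊥) ∧ ∃ x, f x ≠ ⊤

/-- Convexity for `EReal`-valued functions. -/
def ConvexFn (f : E → EReal) : Prop :=
  ∀ x y : E, ∀ a b : ℝ, 0 ≤ a → 0 ≤ b → a + b = 1 →
    f (a • x + b • y) ≤ (a : EReal) * f x + (b : EReal) * f y

/-- The Fenchel conjugate of an `EReal`-valued function. -/
def conj (f : E → EReal) : E → EReal :=
  fun v => ⨆ x : E, ((⟪v, x⟫ : EReal) - f x)

/-- The `ε`-subdifferential (for convex functions). -/
def epsSubdiff (f : E → EReal) (ε : ℝ) (w : E) : Set E :=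
  {v | f w ≠ ⊤ ∧ ∀ y : E, f w + ((⟪v, y - w⟫ - ε : ℝ) : EReal) ≤ f y}

/-- The convex subdifferential. -/
def subdiff (f : E → EReal) (w : E) : Set E := epsSubdiff f 0 w

/-- The Fréchet subdifferential. -/
def frechetSubdiff (f : E → EReal) (w : E) : Set E :=
  {v | f w ≠ ⊤ ∧ ∀ ε : ℝ, 0 < ε →
    ∀ᶠ y in nhds w, f w + ((⟪v, y - w⟫ - ε * ‖y - w‖ : ℝ) : EReal) ≤ f y}

/-- The limiting (Mordukhovich) subdifferential. -/
def limitingSubdiff (f : E → EReal) (w : E) : Set E :=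
  {v | ∃ xs vs : ℕ → E,
      Tendsto xs atTop (nhds w) ∧
      Tendsto (fun k => f (xs k)) atTop (nhds (f w)) ∧
      Tendsto vs atTop (nhds v) ∧
      ∀ k, vs k ∈ frechetSubdiff f (xs k)}

open Classical in
/-- The indicator function of a set, with values in `EReal`. -/
def indicatorFn (S : Set E) : E → EReal := fun x => if x ∈ S then (0 : EReal) else ⊤

/-- Calmness of an `EReal`-valued function at a point. -/
def CalmAt (f : E → EReal) (x : E) : Prop :=
  ∃ ε κ : ℝ, 0 < ε ∧ 0 < κ ∧ ∀ y ∈ ball x ε,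
    f y ≤ f x + ((κ * ‖y - x‖ : ℝ) : EReal) ∧ f x ≤ f y + ((κ * ‖y - x‖ : ℝ) : EReal)

/-- Essential strict convexity: strict convexity on every convex subset of `dom ∂g`. -/
def EssStrictConvexFn (g : F → EReal) : Prop :=
  ∀ C : Set F, Convex ℝ C → (∀ w ∈ C, (subdiff g w).Nonempty) →
    ∀ x ∈ C, ∀ y ∈ C, x ≠ y → ∀ a b : ℝ, 0 < a → 0 < b → a + b = 1 →
      g (a • x + b • y) < (a : EReal) * g x + (b : EReal) * g y

/-- The Kurdyka–Łojasiewicz property at a point. -/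
def KLAt (f : E → EReal) (xh : E) : Prop :=
  ∃ μ : ℝ, 0 < μ ∧ ∃ U ∈ nhds xh, ∃ φ φd : ℝ → ℝ,
    ContinuousOn φ (Ico 0 μ) ∧ ConcaveOn ℝ (Ico 0 μ) φ ∧ φ 0 = 0 ∧
    (∀ t ∈ Ioo 0 μ, HasDerivAt φ (φd t) t ∧ 0 < φd t) ∧
    ∀ x ∈ U, f xh < f x → f x < f xh + (μ : EReal) →
      ∀ v ∈ limitingSubdiff f x, 1 ≤ φd ((f x).toReal - (f xh).toReal) * ‖v‖

/-- The augmented function `Ψ`. -/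
def psi (S : Set E) (g : F → EReal) (h : E → ℝ) (A : E →L[ℝ] F) (δ γ : ℝ)
    (x : E) (z : F) (u : E) : EReal :=
  ((⟪z, A x⟫ + h x + δ / 2 * ‖x - u‖ ^ 2 - γ / 2 * ‖z‖ ^ 2 : ℝ) : EReal)
    - conj g z + indicatorFn S x

/-- Assumption 1 of the paper. `h'` is the gradient of `h` and `Lh` its Lipschitz constant. -/
def Assumption1 (S : Set E) (g : F → EReal) (h : E → ℝ) (h' : E → E) (Lh : ℝ)
    (f : G → EReal) (A : E →L[ℝ] F) (K : E →L[ℝ] G) : Prop :=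
  S.Nonempty ∧ Convex ℝ S ∧ IsCompact S ∧
  ProperFn g ∧ ConvexFn g ∧ LowerSemicontinuous g ∧
  (∃ O : Set E, IsOpen O ∧ S ⊆ O ∧ (∀ x ∈ O, HasGradientAt h (h' x) x) ∧
      ∀ x ∈ O, ∀ y ∈ O, ‖h' x - h' y‖ ≤ Lh * ‖x - y‖) ∧
  ProperFn f ∧ ConvexFn f ∧ LowerSemicontinuous f ∧
  (∀ x ∈ S, K x ∈ interior (edom f)) ∧ (∀ x ∈ S, 0 < f (K x)) ∧
  (∃ x ∈ S, A x ∈ edom g) ∧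
  (∃ α : ℝ, 0 < α ∧ ∀ x ∈ S, (α : EReal) ≤ g (A x) + (h x : EReal))

/-- Assumption 2 of the paper. -/
def Assumption2 (S : Set E) (g : F → EReal) (A : E →L[ℝ] F) : Prop :=
  (∀ x ∈ S, (subdiff g (A x)).Nonempty) ∧
  ∃ ℓ : ℝ, 0 < ℓ ∧ ∀ x ∈ S, infDist 0 (subdiff g (A x)) ≤ ℓ

/-- The constant-parameter algorithm (FSPS with fixed `γ`, `δ`, `β`). -/
def IsAlgoSeq (S : Set E) (g : F → EReal) (h : E → ℝ) (h' : E → E) (f : G → EReal)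
    (A : E →L[ℝ] F) (K : E →L[ℝ] G) (γ δ β : ℝ)
    (x u : ℕ → E) (y : ℕ → G) (z : ℕ → F) (θ : ℕ → ℝ) : Prop :=
  x 0 ∈ S ∧
  (∀ k, ∀ ζ : F, conj g (z k) + ((-⟪z k, A (x k)⟫ + γ / 2 * ‖z k‖ ^ 2 : ℝ) : EReal)
      ≤ conj g ζ + ((-⟪ζ, A (x k)⟫ + γ / 2 * ‖ζ‖ ^ 2 : ℝ) : EReal)) ∧
  (∀ k, 0 < θ k ∧ ((θ k : ℝ) : EReal) * f (K (x k)) = psi S g h A δ γ (x k) (z k) (u k)) ∧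
  (∀ k, y (k + 1) ∈ subdiff f (K (x k))) ∧
  (∀ k, x (k + 1) ∈ S ∧ ∀ w ∈ S,
      ⟪z k, A (x (k + 1))⟫ - θ k * ⟪K (x (k + 1)), y (k + 1)⟫
          + ⟪h' (x k), x (k + 1)⟫ + δ / 2 * ‖x (k + 1) - u k‖ ^ 2
        ≤ ⟪z k, A w⟫ - θ k * ⟪K w, y (k + 1)⟫ + ⟪h' (x k), w⟫
          + δ / 2 * ‖w - u k‖ ^ 2) ∧
  (∀ k, u (k + 1) = (1 - β) • u k + β • x (k + 1))

/-- `x̄` is a limiting `(ε₁, ε₂)`-lifted stationary point of the fractional program. -/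
def IsLiftedStat (S : Set E) (g : F → EReal) (h : E → ℝ) (h' : E → E) (f : G → EReal)
    (A : E →L[ℝ] F) (K : E →L[ℝ] G) (ε₁ ε₂ : ℝ) (xb : E) : Prop :=
  ∃ Ψb : ℝ, |Ψb - ((g (A xb)).toReal + h xb)| ≤ ε₂ ∧
    ∃ v ∈ epsSubdiff g ε₁ (A xb), ∃ w ∈ subdiff (indicatorFn S) xb,
      ∃ s ∈ subdiff f (K xb),
        (f (K xb)).toReal • (ContinuousLinearMap.adjoint A v + h' xb + w)
          - Ψb • (ContinuousLinearMap.adjoint K s) = 0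


/-- The Fréchet subdifferential of a function given by a real-valued function `P` on a set `D`
and by `⊤` off `D` near the base point. -/
theorem mem_frechetSubdiff_iff_of_eq_coe {V : Type*} [NormedAddCommGroup V] [InnerProductSpace ℝ V]
    {φ : V → EReal} {D : Set V} {P : V → ℝ} {x v : V}
    (hx : x ∈ D) (hφ : ∀ y ∈ D, φ y = (P y : EReal)) (htop : ∀ᶠ y in 𝓝 x, y ∉ D → φ y = ⊤) :
    v ∈ frechetSubdiff φ x ↔
      ∀ ε : ℝ, 0 < ε → ∀ᶠ y in 𝓝 x, y ∈ D → ⟪v, y - x⟫ - ε * ‖y - x‖ ≤ P y - P x := by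
  have hne : φ x ≠ ⊤ := by simp [hφ x hx]
  simp only [frechetSubdiff, mem_ofPred_eq, hne, ne_eq, not_false_eq_true, true_and]
  refine forall₂_congr fun ε _ => eventually_congr ?_
  filter_upwards [htop] with y hy
  by_cases hyD : y ∈ D
  · rw [hφ y hyD, hφ x hx, ← EReal.coe_add, EReal.coe_le_coe_iff]
    simp only [hyD, true_imp_iff, le_sub_iff_add_le, add_comm]
  · simp [hy hyD, hyD]

/-- Scaling a first-order lower bound by a positive function continuous at the base point. -/
theorem eventually_inner_sub_le_mul {V : Type*} [NormedAddCommGroup V] [InnerProductSpace ℝ V]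
    {D : Set V} {H c : V → ℝ} {x v : V}
    (hc : ContinuousAt c x) (hcx : 0 < c x)
    (hH : ∀ ε : ℝ, 0 < ε → ∀ᶠ y in 𝓝 x, y ∈ D → ⟪v, y - x⟫ - ε * ‖y - x‖ ≤ H y)
    {ε : ℝ} (hε : 0 < ε) :
    ∀ᶠ y in 𝓝 x, y ∈ D → ⟪c x • v, y - x⟫ - ε * ‖y - x‖ ≤ c y * H y := by
  have hlim : Tendsto (fun y => |c y - c x| * ‖v‖ + c y * (ε / (2 * c x))) (𝓝 x)
      (𝓝 (|c x - c x| * ‖v‖ + c x * (ε / (2 * c x)))) :=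
    ((((hc.tendsto.sub_const _).abs).mul_const _).add (hc.tendsto.mul_const _))
  have hlt : |c x - c x| * ‖v‖ + c x * (ε / (2 * c x)) < ε := by
    have : c x * (ε / (2 * c x)) = ε / 2 := by field_simp
    rw [this]
    simp only [sub_self, abs_zero, zero_mul, zero_add]
    linarith
  filter_upwards [hH (ε / (2 * c x)) (by positivity), hlim.eventually_lt_const hlt,
    hc.eventually (lt_mem_nhds hcx)] with y hy hyε hcy hyD
  have hmul := mul_le_mul_of_nonneg_left (hy hyD) hcy.le
  have hinner : (c x - c y) * ⟪v, y - x⟫ ≤ |c y - c x| * (‖v‖ * ‖y - x‖) := by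
    refine (le_abs_self _).trans ?_
    rw [abs_mul, abs_sub_comm]
    exact mul_le_mul_of_nonneg_left (abs_real_inner_le_norm _ _) (abs_nonneg _)
  have hnorm := mul_le_mul_of_nonneg_right hyε.le (norm_nonneg (y - x))
  rw [real_inner_smul_left]
  linarith

/-- A function calm at a point is continuous there. -/
theorem continuousAt_of_abs_sub_le_mul_norm {V : Type*} [NormedAddCommGroup V]
    {f : V → ℝ} {x : V}
    (h : ∃ ε κ : ℝ, 0 < ε ∧ 0 < κ ∧ ∀ y ∈ ball x ε, |f y - f x| ≤ κ * ‖y - x‖) :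
    ContinuousAt f x := by
  obtain ⟨ε, κ, hε, -, h⟩ := h
  refine continuousAt_of_locally_lipschitz hε κ fun y hy => ?_
  rw [Real.dist_eq, dist_eq_norm]
  exact h y hy

/-- Fréchet subdifferential of a quotient (equality case). -/
theorem frechetSubdiff_ratio_eq
    (O : Set E) (hO : IsOpen O) (x : E) (hxO : x ∈ O)
    (f₁ : E → EReal) (f₂ : E → ℝ)
    (hf₁bot : ∀ y, f₁ y ≠ ⊥) (hf₁fin : f₁ x ≠ ⊤) (hf₂pos : 0 < f₂ x)
    (hcont : ContinuousWithinAt f₁ (edom f₁) x)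
    (hcalm : ∃ ε κ : ℝ, 0 < ε ∧ 0 < κ ∧ ∀ y ∈ ball x ε, |f₂ y - f₂ x| ≤ κ * ‖y - x‖)
    (α₁ α₂ : ℝ) (hα₁ : (α₁ : EReal) = f₁ x) (hα₂ : α₂ = f₂ x) :
    frechetSubdiff (fun y => f₁ y / ((f₂ y : ℝ) : EReal)) x =
      (fun v => (1 / f₂ x ^ 2) • v) ''
        frechetSubdiff (fun y => (α₂ : EReal) * f₁ y - ((α₁ * f₂ y : ℝ) : EReal)) x := by
  subst hα₂
  have hf₂ : ContinuousAt f₂ x := continuousAt_of_abs_sub_le_mul_norm hcalm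
  have hpos : ∀ᶠ y in 𝓝 x, 0 < f₂ y := hf₂.eventually (lt_mem_nhds hf₂pos)
  have hcoe : ∀ y ∈ edom f₁, f₁ y = ((f₁ y).toReal : EReal) := fun y hy =>
    (EReal.coe_toReal hy (hf₁bot y)).symm
  have hx : x ∈ edom f₁ := hf₁fin
  have hα : (f₁ x).toReal = α₁ := by rw [← hα₁, EReal.toReal_coe]
  have hquot (v : E) := mem_frechetSubdiff_iff_of_eq_coe (v := v)
    (φ := fun y => f₁ y / ((f₂ y : ℝ) : EReal)) (P := fun y => (f₁ y).toReal / f₂ y) hx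
    (fun y hy => by rw [EReal.coe_div, ← hcoe y hy])
    (by
      filter_upwards [hpos] with y hy hyD
      rw [show f₁ y = ⊤ from not_not.mp hyD]
      exact EReal.top_div_of_pos_ne_top (EReal.coe_pos.mpr hy) (EReal.coe_ne_top _))
  have hdiff (v : E) := mem_frechetSubdiff_iff_of_eq_coe (v := v)
    (φ := fun y => (f₂ x : EReal) * f₁ y - ((α₁ * f₂ y : ℝ) : EReal))
    (P := fun y => f₂ x * (f₁ y).toReal - α₁ * f₂ y) hx
    (fun y hy => by rw [EReal.coe_sub, EReal.coe_mul (f₂ x), ← hcoe y hy])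
    (by
      refine Eventually.of_forall fun y hyD => ?_
      rw [show f₁ y = ⊤ from not_not.mp hyD]
      simp only [EReal.coe_mul_top_of_pos hf₂pos, EReal.top_sub_coe])
  have hne := hf₂pos.ne'
  ext w
  simp only [mem_image, hquot, hdiff, hα]
  constructor
  · intro hw
    refine ⟨(f₂ x * f₂ x) • w, fun ε hε => ?_, ?_⟩
    · filter_upwards [eventually_inner_sub_le_mul (c := fun y => f₂ x * f₂ y)
        (hf₂.const_mul _) (mul_pos hf₂pos hf₂pos) hw hε, hpos] with y hy hfy hyD
      refine (hy hyD).trans_eq ?_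
      have := hfy.ne'
      field_simp
      ring
    · rw [smul_smul, show 1 / f₂ x ^ 2 * (f₂ x * f₂ x) = 1 by field_simp, one_smul]
  · rintro ⟨v, hv, rfl⟩ ε hε
    filter_upwards [eventually_inner_sub_le_mul (c := fun y => 1 / (f₂ x * f₂ y))
      (continuousAt_const.div (hf₂.const_mul _) (mul_pos hf₂pos hf₂pos).ne')
      (by positivity) hv hε, hpos] with y hy hfy hyD
    rw [sq]
    refine (hy hyD).trans_eq ?_
    have := hfy.ne'
    field_simp
    ring

end FracPaper
end
end

section
/- Let O ⊆ ℝⁿ be an open set, f₁ : O → ℝ ∪ {+∞} and f₂ : O → ℝ two functions which are finite at a point x ∈ O with f₂(x) > 0. Suppose f₁ is continuous at x relative to dom f₁, f₂ is calm at x, and set α₁ := f₁(x), α₂ := f₂(x). If in addition f₂ is convex and α₁ ≥ 0, then ∂̂(f₁/f₂)(x) ⊆ (1/f₂(x)²) · (∂̂(α₂ f₁)(x) − α₁ ∂̂f₂(x)), where the right-hand side is the Minkowski difference set scaled by 1/f₂(x)². -/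
open Set Filter Topology Metric

open scoped RealInnerProductSpace

noncomputable section

namespace FracPaper

variable {E : Type*} [NormedAddCommGroup E] [InnerProductSpace ℝ E] [FiniteDimensional ℝ E]
variable {F : Type*} [NormedAddCommGroup F] [InnerProductSpace ℝ F] [FiniteDimensional ℝ F]
variable {G : Type*} [NormedAddCommGroup G] [InnerProductSpace ℝ G] [FiniteDimensional ℝ G]

/-- A finite convex function on a finite-dimensional inner product space has a subgradient at
every point. -/
theorem exists_subgradient_of_convexOn_univ {V : Type*} [NormedAddCommGroup V]
    [InnerProductSpace ℝ V] [FiniteDimensional ℝ V] {f : V → ℝ} (hf : ConvexOn ℝ univ f) (x : V) :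
    ∃ s : V, ∀ y, f x + ⟪s, y - x⟫ ≤ f y := by
  have hfc : Continuous f := continuousOn_univ.mp (hf.continuousOn isOpen_univ)
  have hopen : IsOpen {p : V × ℝ | p.1 ∈ univ ∧ f p.1 < p.2} := by
    simpa using isOpen_lt (hfc.comp continuous_fst) continuous_snd
  obtain ⟨φ, hφ⟩ := geometric_hahn_banach_open_point (x := (x, f x))
    hf.convex_strict_epigraph hopen (by simp)
  have hsplit (y : V) (t : ℝ) : φ (y, t) = φ (y, 0) + t * φ (0, 1) := by
    rw [← smul_eq_mul, ← map_smul, ← map_add]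
    simp
  have hneg : φ (0, 1) < 0 := by
    have h := hφ (x, f x + 1) ⟨mem_univ _, by simp⟩
    rw [hsplit x (f x + 1), hsplit x (f x)] at h
    linarith
  have hle (y : V) : φ (y, f y) ≤ φ (x, f x) := by
    have hlim : Tendsto (fun t : ℝ => φ (y, t)) (𝓝[>] f y) (𝓝 (φ (y, f y))) :=
      ((by fun_prop : Continuous fun t : ℝ => φ (y, t)).tendsto _).mono_left nhdsWithin_le_nhds
    refine le_of_tendsto hlim ?_
    filter_upwards [self_mem_nhdsWithin] with t ht
    exact (hφ (y, t) ⟨mem_univ _, ht⟩).le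
  let L : StrongDual ℝ V := (-φ (0, 1))⁻¹ • φ.comp (ContinuousLinearMap.inl ℝ V ℝ)
  refine ⟨(InnerProductSpace.toDual ℝ V).symm L, fun y => ?_⟩
  have hL : ⟪(InnerProductSpace.toDual ℝ V).symm L, y - x⟫
      = (-φ (0, 1))⁻¹ * (φ (y, 0) - φ (x, 0)) := by
    rw [InnerProductSpace.toDual_symm_apply, map_sub]
    simp [L, mul_sub]
  have h := hle y
  rw [hsplit y (f y), hsplit x (f x)] at h
  have hbound : (-φ (0, 1))⁻¹ * (φ (y, 0) - φ (x, 0)) ≤ f y - f x := by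
    rw [inv_mul_le_iff₀ (by linarith)]
    linarith
  linarith

/-- Fréchet subdifferential of a quotient (inclusion under convexity). -/
theorem frechetSubdiff_ratio_subset
    (O : Set E) (hO : IsOpen O) (x : E) (hxO : x ∈ O)
    (f₁ : E → EReal) (f₂ : E → ℝ)
    (hf₁bot : ∀ y, f₁ y ≠ ⊥) (hf₁fin : f₁ x ≠ ⊤) (hf₂pos : 0 < f₂ x)
    (hcont : ContinuousWithinAt f₁ (edom f₁) x)
    (hcalm : ∃ ε κ : ℝ, 0 < ε ∧ 0 < κ ∧ ∀ y ∈ ball x ε, |f₂ y - f₂ x| ≤ κ * ‖y - x‖)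
    (hconv : ConvexOn ℝ univ f₂)
    (α₁ α₂ : ℝ) (hα₁ : (α₁ : EReal) = f₁ x) (hα₂ : α₂ = f₂ x) (hα₁nonneg : 0 ≤ α₁) :
    frechetSubdiff (fun y => f₁ y / ((f₂ y : ℝ) : EReal)) x ⊆
      {w | ∃ v ∈ frechetSubdiff (fun y => (α₂ : EReal) * f₁ y) x,
           ∃ s ∈ frechetSubdiff (fun y => ((f₂ y : ℝ) : EReal)) x,
           w = (1 / f₂ x ^ 2) • (v - α₁ • s)} := by
  rintro w ⟨-, hw⟩
  obtain ⟨s, hs⟩ := exists_subgradient_of_convexOn_univ hconv x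
  subst hα₂
  refine ⟨f₂ x ^ 2 • w + α₁ • s, ⟨?_, fun ε hε => ?_⟩, s, ⟨EReal.coe_ne_top _, fun ε hε => ?_⟩, ?_⟩
  · simp only [← hα₁, ← EReal.coe_mul]
    exact EReal.coe_ne_top _
  · have hf₂c : ContinuousAt f₂ x :=
      (continuousOn_univ.mp (hconv.continuousOn isOpen_univ)).continuousAt
    have hε' : 0 < ε / (2 * f₂ x * (f₂ x + 1)) := by positivity
    have hη : 0 < ε / (2 * f₂ x * (‖w‖ + 1)) := by positivity
    filter_upwards [hw _ hε', hf₂c.eventually (lt_mem_nhds hf₂pos),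
      hf₂c.eventually (gt_mem_nhds (lt_add_one (f₂ x))),
      hf₂c.eventually (ball_mem_nhds _ hη)] with y hy hpos hlt hnear
    simp only [← hα₁, ← EReal.coe_mul, ← EReal.coe_div, ← EReal.coe_add] at hy ⊢
    generalize h₁ : f₁ y = a at hy
    induction a with
    | bot => exact absurd h₁ (hf₁bot y)
    | top => simp [EReal.coe_mul_top_of_pos hf₂pos]
    | coe a =>
      rw [← EReal.coe_div, EReal.coe_le_coe_iff, le_div_iff₀ hpos] at hy
      rw [← EReal.coe_mul, EReal.coe_le_coe_iff]
      rw [Real.dist_eq, lt_div_iff₀ (by positivity)] at hnear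
      simp only [inner_add_left, real_inner_smul_left]
      have hsub : α₁ * ⟪s, y - x⟫ ≤ α₁ * (f₂ y - f₂ x) :=
        mul_le_mul_of_nonneg_left (by linarith [hs y]) hα₁nonneg
      have hcross : f₂ x * ((f₂ x - f₂ y) * ⟪w, y - x⟫) ≤ ε / 2 * ‖y - x‖ := by
        have h₂ : (f₂ x - f₂ y) * ⟪w, y - x⟫ ≤ |f₂ y - f₂ x| * ((‖w‖ + 1) * ‖y - x‖) := by
          refine (le_abs_self _).trans ?_
          rw [abs_mul, abs_sub_comm]
          gcongr
          refine (abs_real_inner_le_norm _ _).trans ?_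
          gcongr
          linarith
        have h₃ := mul_le_mul_of_nonneg_left h₂ hf₂pos.le
        have h₄ := mul_le_mul_of_nonneg_right hnear.le (norm_nonneg (y - x))
        linarith
      have herr : f₂ x * (ε / (2 * f₂ x * (f₂ x + 1)) * ‖y - x‖ * f₂ y) ≤ ε / 2 * ‖y - x‖ := by
        calc f₂ x * (ε / (2 * f₂ x * (f₂ x + 1)) * ‖y - x‖ * f₂ y)
            ≤ f₂ x * (ε / (2 * f₂ x * (f₂ x + 1)) * ‖y - x‖ * (f₂ x + 1)) := by gcongr
          _ = ε / 2 * ‖y - x‖ := by field_simp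
      have hmain := mul_le_mul_of_nonneg_left hy hf₂pos.le
      have hquot : f₂ x * (α₁ / f₂ x * f₂ y) = α₁ * f₂ y := by field_simp
      linarith
  · refine Eventually.of_forall fun y => ?_
    rw [← EReal.coe_add, EReal.coe_le_coe_iff]
    have : 0 ≤ ε * ‖y - x‖ := by positivity
    linarith [hs y]
  · rw [add_sub_cancel_right, smul_smul, one_div, inv_mul_cancel₀ (by positivity), one_smul]

end FracPaper
end
end

section
/- Let g : ℝⁿ → ℝ be a convex function with full domain which is differentiable with L_{∇g}-Lipschitz continuous gradient (L_{∇g} > 0), let w ∈ ℝⁿ, ε > 0, and let z ∈ ℝⁿ be such that dist(w, ∂g*(z)) := inf{‖w − η‖ : η ∈ ∂g*(z)} ≤ ε. Then z ∈ ∂_{ε̂} g(w) with ε̂ := (L_{∇g}/2)ε². -/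
open Set Filter Topology Metric

open scoped RealInnerProductSpace

noncomputable section

namespace FracPaper

variable {E : Type*} [NormedAddCommGroup E] [InnerProductSpace ℝ E] [FiniteDimensional ℝ E]
variable {F : Type*} [NormedAddCommGroup F] [InnerProductSpace ℝ F] [FiniteDimensional ℝ F]
variable {G : Type*} [NormedAddCommGroup G] [InnerProductSpace ℝ G] [FiniteDimensional ℝ G]

/-- The derivative of a function along a line, in terms of its gradient. -/
lemma hasDerivAt_line {g : E → ℝ} {g' : E → E} (hgrad : ∀ x : E, HasGradientAt g (g' x) x)
    (x d : E) (t : ℝ) :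
    HasDerivAt (fun s : ℝ => g (x + s • d)) ⟪g' (x + t • d), d⟫ t := by
  have h1 : HasDerivAt (fun s : ℝ => x + s • d) d t := by
    simpa using ((hasDerivAt_id t).smul_const d).const_add x
  simpa [Function.comp_def] using (hgrad (x + t • d)).hasFDerivAt.comp_hasDerivAt t h1

/-- The first-order characterization of convexity. -/
lemma gradient_inequality {g : E → ℝ} {g' : E → E} (hconv : ConvexOn ℝ univ g)
    (hgrad : ∀ x : E, HasGradientAt g (g' x) x) (x y : E) :
    g x + ⟪g' x, y - x⟫ ≤ g y := by
  have hc : ConvexOn ℝ univ (fun s : ℝ => g (x + s • (y - x))) := by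
    have := hconv.comp_affineMap (AffineMap.lineMap (k := ℝ) x y)
    simpa [Function.comp_def, AffineMap.lineMap_apply, add_comm] using this
  have hd := hasDerivAt_line hgrad x (y - x) 0
  have := hc.le_slope_of_hasDerivAt (mem_univ 0) (mem_univ 1) one_pos hd
  simp only [slope_def_field, zero_smul, add_zero, one_smul, add_sub_cancel, sub_zero,
    div_one] at this
  simp only [inner_sub_right] at *
  linarith

/-- The descent lemma for functions with Lipschitz gradient. -/
lemma descent_lemma {g : E → ℝ} {g' : E → E} {L : ℝ}
    (hgrad : ∀ x : E, HasGradientAt g (g' x) x)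
    (hlip : ∀ x y : E, ‖g' x - g' y‖ ≤ L * ‖x - y‖) (x y : E) :
    g y ≤ g x + ⟪g' x, y - x⟫ + L / 2 * ‖y - x‖ ^ 2 := by
  set d := y - x with hd
  have hder : ∀ t : ℝ, HasDerivAt
      (fun s : ℝ => g (x + s • d) - s * ⟪g' x, d⟫ - L / 2 * ‖d‖ ^ 2 * s ^ 2)
      (⟪g' (x + t • d), d⟫ - ⟪g' x, d⟫ - L * ‖d‖ ^ 2 * t) t := by
    intro t
    have h := ((hasDerivAt_line hgrad x d t).sub
      ((hasDerivAt_id t).mul_const ⟪g' x, d⟫)).sub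
      (((hasDerivAt_id t).pow 2).const_mul (L / 2 * ‖d‖ ^ 2))
    refine h.congr_deriv ?_
    simp
    ring
  have hanti := antitoneOn_of_deriv_nonpos (convex_Ici (0 : ℝ))
    (fun t _ => (hder t).continuousAt.continuousWithinAt)
    (fun t _ => (hder t).differentiableAt.differentiableWithinAt) (by
      intro t ht
      rw [interior_Ici, mem_Ioi] at ht
      rw [(hder t).deriv, ← inner_sub_left]
      have h1 := real_inner_le_norm (g' (x + t • d) - g' x) d
      have h2 := hlip (x + t • d) x
      rw [add_sub_cancel_left, norm_smul, Real.norm_of_nonneg ht.le] at h2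
      nlinarith [mul_le_mul_of_nonneg_right h2 (norm_nonneg d)])
  have := hanti (mem_Ici.2 le_rfl) (mem_Ici.2 zero_le_one) zero_le_one
  simp [hd] at this
  rw [← hd] at this
  linarith

/-- A global affine minorant of `g` touching at `x` has slope the gradient of `g` at `x`. -/
lemma eq_gradient_of_subgradient {g : E → ℝ} {x v z : E} (hgrad : HasGradientAt g v x)
    (hz : ∀ y, g x + ⟪z, y - x⟫ ≤ g y) : z = v := by
  have hmin : IsLocalMin (fun y => g y - innerSL ℝ z y) x := by
    refine Eventually.of_forall fun y => ?_
    have := hz y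
    simp only [inner_sub_right] at this
    simp only [innerSL_apply_apply]
    linarith
  have h0 := hmin.hasFDerivAt_eq_zero (hgrad.hasFDerivAt.sub (innerSL ℝ z).hasFDerivAt)
  refine ext_inner_right ℝ fun d => ?_
  have := congrArg (fun T : E →L[ℝ] ℝ => T d) h0
  simp at this
  linarith

/-- For differentiable convex `g`, subgradients of the conjugate invert the subdifferential. -/
lemma subgradient_of_mem_subdiff_conj {g : E → ℝ} {g' : E → E} (hconv : ConvexOn ℝ univ g)
    (hgrad : ∀ x : E, HasGradientAt g (g' x) x) {z η : E}
    (hη : η ∈ subdiff (conj fun x => ((g x : ℝ) : EReal)) z) (y : E) :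
    g η + ⟪z, y - η⟫ ≤ g y := by
  have hle : conj (fun x => ((g x : ℝ) : EReal)) (g' η) ≤ ((⟪g' η, η⟫ - g η : ℝ) : EReal) := by
    refine iSup_le fun x => ?_
    rw [← EReal.coe_sub, EReal.coe_le_coe_iff]
    have := gradient_inequality hconv hgrad η x
    rw [inner_sub_right] at this
    linarith
  have hge : ((⟪z, y⟫ - g y : ℝ) : EReal) ≤ conj (fun x => ((g x : ℝ) : EReal)) z :=
    le_iSup (fun x : E => ((⟪z, x⟫ : EReal) - ((g x : ℝ) : EReal))) y
  have h := (add_le_add_left hge _).trans ((hη.2 (g' η)).trans hle)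
  rw [← EReal.coe_add, EReal.coe_le_coe_iff] at h
  simp only [inner_sub_right, real_inner_comm η] at h ⊢
  linarith

/-- approximate subgradients from approximate conjugate subgradients
(smooth case). -/
theorem mem_epsSubdiff_of_dist_le_smooth
    (g : E → ℝ) (g' : E → E) (L : ℝ) (hL : 0 < L)
    (hconv : ConvexOn ℝ univ g)
    (hgrad : ∀ x : E, HasGradientAt g (g' x) x)
    (hlip : ∀ x y : E, ‖g' x - g' y‖ ≤ L * ‖x - y‖)
    (w z : E) (ε : ℝ) (hε : 0 < ε)
    (hne : (subdiff (conj fun x => ((g x : ℝ) : EReal)) z).Nonempty)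
    (hdist : infDist w (subdiff (conj fun x => ((g x : ℝ) : EReal)) z) ≤ ε) :
    z ∈ epsSubdiff (fun x => ((g x : ℝ) : EReal)) (L / 2 * ε ^ 2) w := by
  refine ⟨EReal.coe_ne_top _, fun y => ?_⟩
  rw [← EReal.coe_add, EReal.coe_le_coe_iff]
  have key : ∀ r : ℝ, ε < r → g w + ⟪z, y - w⟫ - L / 2 * r ^ 2 ≤ g y := by
    intro r hr
    obtain ⟨η, hη, hdη⟩ := (infDist_lt_iff hne).1 (hdist.trans_lt hr)
    have hsub := subgradient_of_mem_subdiff_conj hconv hgrad hη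
    have hz := eq_gradient_of_subgradient (hgrad η) hsub
    have h1 := descent_lemma hgrad hlip η w
    rw [← hz] at h1
    have h2 := hsub y
    rw [dist_eq_norm] at hdη
    have h3 : L / 2 * ‖w - η‖ ^ 2 ≤ L / 2 * r ^ 2 := by gcongr
    simp only [inner_sub_right] at *
    linarith
  have hlim : Tendsto (fun r : ℝ => g w + ⟪z, y - w⟫ - L / 2 * r ^ 2) (𝓝[>] ε)
      (𝓝 (g w + ⟪z, y - w⟫ - L / 2 * ε ^ 2)) :=
    (Continuous.tendsto (by fun_prop) ε).mono_left nhdsWithin_le_nhds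
  have := le_of_tendsto hlim (eventually_nhdsWithin_of_forall key)
  linarith

end FracPaper
end
end

section
/- Suppose Assumption 1 holds and x̄ is a Fréchet stationary point of problem (P), i.e., 0 ∈ ∂̂((g∘A + h + ι_S)/(f∘K))(x̄), such that Kx̄ ∈ int(dom f), and either x̄ ∈ ri(S) ∩ A⁻¹(ri(dom g)), or S is polyhedral and x̄ ∈ S ∩ A⁻¹(ri(dom g)). Then x̄ is a limiting lifted stationary point of (P), i.e., 0 ∈ (A*∂g(Ax̄) + ∇h(x̄) + ∂ι_S(x̄)) · f(Kx̄) − (g(Ax̄)+h(x̄)) · K*∂f(Kx̄). -/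
open Set Filter Topology Metric

open scoped RealInnerProductSpace

noncomputable section

namespace FracPaper

variable {E : Type*} [NormedAddCommGroup E] [InnerProductSpace ℝ E] [FiniteDimensional ℝ E]
variable {F : Type*} [NormedAddCommGroup F] [InnerProductSpace ℝ F] [FiniteDimensional ℝ F]
variable {G : Type*} [NormedAddCommGroup G] [InnerProductSpace ℝ G] [FiniteDimensional ℝ G]

/-- A polyhedral subset: a finite intersection of closed halfspaces. -/
def IsPolyhedral (S : Set E) : Prop :=
  ∃ (m : ℕ) (φ : Fin m → E →L[ℝ] ℝ) (c : Fin m → ℝ), S = {x | ∀ i, φ i x ≤ c i}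

/-- Farkas' lemma over an arbitrary real vector space. -/
lemma farkas {M : Type*} [AddCommGroup M] [Module ℝ M] {ι : Type*} (s : Finset ι) :
    ∀ (ψ : ι → M →ₗ[ℝ] ℝ) (p : M →ₗ[ℝ] ℝ),
      (∀ x, (∀ i ∈ s, ψ i x ≤ 0) → p x ≤ 0) →
      ∃ c : ι → ℝ, (∀ i ∈ s, 0 ≤ c i) ∧ p = ∑ i ∈ s, c i • ψ i := by
  classical
  induction s using Finset.induction_on with
  | empty =>
    intro ψ p hp
    refine ⟨0, by simp, LinearMap.ext fun x => ?_⟩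
    have h₁ := hp x (by simp)
    have h₂ := hp (-x) (by simp)
    simp only [map_neg] at h₂
    simp only [Finset.sum_empty, LinearMap.zero_apply]
    linarith
  | insert j s hj ih =>
    intro ψ p hp
    by_cases hs : ∀ x, (∀ i ∈ s, ψ i x ≤ 0) → p x ≤ 0
    · obtain ⟨c, hc, rfl⟩ := ih ψ p hs
      refine ⟨Function.update c j 0, fun i hi => ?_, ?_⟩
      · by_cases hij : i = j
        · simp [hij]
        · simpa [hij] using hc i ((Finset.mem_insert.1 hi).resolve_left hij)
      · rw [Finset.sum_insert hj]
        simp only [Function.update_self, zero_smul, zero_add]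
        refine Finset.sum_congr rfl fun i hi => ?_
        rw [Function.update_of_ne (ne_of_mem_of_not_mem hi hj)]
    · push Not at hs
      obtain ⟨e, he, hpe⟩ := hs
      have hje : 0 < ψ j e := by
        by_contra! hle
        refine hpe.not_ge (hp e fun i hi => ?_)
        rcases Finset.mem_insert.1 hi with rfl | hi
        exacts [hle, he i hi]
      set π : M →ₗ[ℝ] M := LinearMap.id - ((ψ j e)⁻¹ • ψ j).smulRight e with hπ
      have hπx : ∀ x, π x = x - ((ψ j e)⁻¹ * ψ j x) • e := fun x => by simp [hπ]
      obtain ⟨c, hc, hpc⟩ := ih (fun i => ψ i ∘ₗ π) (p ∘ₗ π) fun x hx => by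
        refine hp (π x) fun i hi => ?_
        rcases Finset.mem_insert.1 hi with rfl | hi
        · rw [hπx, map_sub, map_smul, smul_eq_mul]
          field_simp
          simp
        · exact hx i hi
      refine ⟨Function.update c j ((ψ j e)⁻¹ * (p e - ∑ i ∈ s, c i * ψ i e)), fun i hi => ?_, ?_⟩
      · by_cases hij : i = j
        · subst hij
          have : ∑ i ∈ s, c i * ψ i e ≤ 0 :=
            Finset.sum_nonpos fun k hk => mul_nonpos_of_nonneg_of_nonpos (hc k hk) (he k hk)
          rw [Function.update_self]
          exact mul_nonneg (inv_nonneg.2 hje.le) (by linarith)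
        · simpa [hij] using hc i ((Finset.mem_insert.1 hi).resolve_left hij)
      · have hupd : ∀ b : ℝ, ∑ i ∈ s, Function.update c j b i • ψ i = ∑ i ∈ s, c i • ψ i :=
          fun b => Finset.sum_congr rfl fun i hi => by
            rw [Function.update_of_ne (ne_of_mem_of_not_mem hi hj)]
        rw [Finset.sum_insert hj, Function.update_self, hupd]
        ext x
        have hx := LinearMap.congr_fun hpc x
        simp only [LinearMap.comp_apply, hπx, map_sub, map_smul, smul_eq_mul, LinearMap.sum_apply,
          LinearMap.smul_apply, mul_sub, Finset.sum_sub_distrib] at hx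
        have hs : ∑ i ∈ s, c i * ((ψ j e)⁻¹ * ψ j x * ψ i e)
            = (ψ j e)⁻¹ * ψ j x * ∑ i ∈ s, c i * ψ i e := by
          rw [Finset.mul_sum]
          exact Finset.sum_congr rfl fun i _ => by ring
        simp only [LinearMap.add_apply, LinearMap.smul_apply, smul_eq_mul, LinearMap.sum_apply]
        rw [hs] at hx
        linear_combination hx

/-- A linear functional vanishing on `W ⊓ V.comap A` splits as a functional vanishing on `W` plus
the pullback along `A` of a functional vanishing on `V`. -/
lemma exists_split_of_eq_zero_on_inf_comap {M N : Type*} [AddCommGroup M] [Module ℝ M]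
    [AddCommGroup N] [Module ℝ N] (A : M →ₗ[ℝ] N) (W : Submodule ℝ M) (V : Submodule ℝ N)
    (q : M →ₗ[ℝ] ℝ) (hq : ∀ d ∈ W, A d ∈ V → q d = 0) :
    ∃ (χ : M →ₗ[ℝ] ℝ) (η : N →ₗ[ℝ] ℝ), (∀ d ∈ W, χ d = 0) ∧ (∀ u ∈ V, η u = 0) ∧
      ∀ d, q d = χ d + η (A d) := by
  let B : M →ₗ[ℝ] (M ⧸ W) × (N ⧸ V) := W.mkQ.prod (V.mkQ ∘ₗ A)
  have hmem : q ∈ LinearMap.range B.dualMap := by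
    rw [LinearMap.range_dualMap_eq_dualAnnihilator_ker, Submodule.mem_dualAnnihilator]
    intro d hd
    have hd' : W.mkQ d = 0 ∧ V.mkQ (A d) = 0 := by
      simpa [B, Prod.ext_iff] using hd
    simp only [Submodule.mkQ_apply, Submodule.Quotient.mk_eq_zero] at hd'
    exact hq d hd'.1 hd'.2
  obtain ⟨ρ, rfl⟩ := hmem
  refine ⟨ρ ∘ₗ LinearMap.inl ℝ _ _ ∘ₗ W.mkQ, ρ ∘ₗ LinearMap.inr ℝ _ _ ∘ₗ V.mkQ, ?_, ?_, ?_⟩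
  · intro d hd
    simp only [LinearMap.comp_apply, Submodule.mkQ_apply, (Submodule.Quotient.mk_eq_zero W).2 hd,
      map_zero]
  · intro u hu
    simp only [LinearMap.comp_apply, Submodule.mkQ_apply, (Submodule.Quotient.mk_eq_zero V).2 hu,
      map_zero]
  · intro d
    simp [B, ← map_add]

/-- If `a` is in the relative interior of the domain `C` of the convex function `γ`, a linear
functional `p` on a convex cone dominated by the increments of `γ` along `A` is dominated by the
pullback of a subgradient of `γ` at `a`. -/
lemma exists_subgradient_dominating {M N : Type*} [AddCommGroup M] [Module ℝ M]
    [AddCommGroup N] [Module ℝ N] {C : Set N} {γ : N → ℝ} (hγ : ConvexOn ℝ C γ) {a : N}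
    (ha : a ∈ C) (V : Submodule ℝ N) (hV : ∀ u ∈ V, ∃ t : ℝ, 0 < t ∧ a + t • u ∈ C)
    (A : M →ₗ[ℝ] N) (p : M →ₗ[ℝ] ℝ) (T : PointedCone ℝ M) (hT : ∀ d ∈ T, A d ∈ V)
    (hp : ∀ d ∈ T, ∀ τ : ℝ, 0 < τ → a + τ • A d ∈ C → τ * p d ≤ γ (a + τ • A d) - γ a) :
    ∃ v : N →ₗ[ℝ] ℝ, (∀ u ∈ V, a + u ∈ C → v u ≤ γ (a + u) - γ a) ∧
      ∀ d ∈ T, p d ≤ v (A d) := by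
  have hcomb : ∀ u₁ u₂ : N, ∀ t₁ t₂ : ℝ, 0 < t₁ → 0 < t₂ → a + t₁ • u₁ ∈ C → a + t₂ • u₂ ∈ C →
      a + (t₁ * t₂ / (t₁ + t₂)) • (u₁ + u₂) ∈ C ∧
      (γ (a + (t₁ * t₂ / (t₁ + t₂)) • (u₁ + u₂)) - γ a) / (t₁ * t₂ / (t₁ + t₂)) ≤
        (γ (a + t₁ • u₁) - γ a) / t₁ + (γ (a + t₂ • u₂) - γ a) / t₂ := by
    intro u₁ u₂ t₁ t₂ h₁ h₂ hc₁ hc₂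
    have hsum : t₂ / (t₁ + t₂) + t₁ / (t₁ + t₂) = 1 := by field_simp; ring
    have heq : (t₂ / (t₁ + t₂)) • (a + t₁ • u₁) + (t₁ / (t₁ + t₂)) • (a + t₂ • u₂)
        = a + (t₁ * t₂ / (t₁ + t₂)) • (u₁ + u₂) := by
      match_scalars <;> field_simp
      ring
    have hmem := hγ.1 hc₁ hc₂ (by positivity) (by positivity) hsum
    have hle := hγ.2 hc₁ hc₂ (by positivity) (by positivity) hsum
    rw [heq] at hmem hle
    refine ⟨hmem, ?_⟩
    rw [div_le_iff₀ (by positivity)]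
    simp only [smul_eq_mul] at hle
    refine (sub_le_sub_right hle _).trans (le_of_eq ?_)
    field_simp
    ring
  let Q : V → Set ℝ := fun u => {r | ∃ t : ℝ, 0 < t ∧ ∃ d ∈ T, a + t • ((u : N) + A d) ∈ C ∧
    r = (γ (a + t • ((u : N) + A d)) - γ a) / t - p d}
  have hne : ∀ u, (Q u).Nonempty := fun u => by
    obtain ⟨t, ht, hmem⟩ := hV u u.2
    exact ⟨_, t, ht, 0, T.zero_mem, by simpa using hmem, rfl⟩
  have hbdd : ∀ u, BddBelow (Q u) := fun u => by
    obtain ⟨s, hs, hmem⟩ := hV (-u) (neg_mem u.2)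
    refine ⟨-((γ (a + s • -(u : N)) - γ a) / s), ?_⟩
    rintro _ ⟨t, ht, d, hd, hc, rfl⟩
    obtain ⟨hc', hle⟩ := hcomb _ _ t s ht hs hc hmem
    have hud : (u : N) + A d + -(u : N) = A d := by abel
    rw [hud] at hc' hle
    have hτ : 0 < t * s / (t + s) := by positivity
    have := hp d hd _ hτ hc'
    have : p d ≤ (γ (a + (t * s / (t + s)) • A d) - γ a) / (t * s / (t + s)) := by
      rw [le_div_iff₀ hτ]; linarith
    linarith
  let m : V → ℝ := fun u => sInf (Q u)
  have hle : ∀ u r, r ∈ Q u → m u ≤ r := fun u r hr => csInf_le (hbdd u) hr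
  have hadd : ∀ u₁ u₂, m (u₁ + u₂) ≤ m u₁ + m u₂ := by
    intro u₁ u₂
    refine le_of_forall_pos_lt_add fun ε hε => ?_
    obtain ⟨r₁, hr₁, hlt₁⟩ := exists_lt_of_csInf_lt (hne u₁)
      (lt_add_of_pos_right (m u₁) (half_pos hε))
    obtain ⟨r₂, hr₂, hlt₂⟩ := exists_lt_of_csInf_lt (hne u₂)
      (lt_add_of_pos_right (m u₂) (half_pos hε))
    obtain ⟨t₁, ht₁, d₁, hd₁, hc₁, rfl⟩ := hr₁
    obtain ⟨t₂, ht₂, d₂, hd₂, hc₂, rfl⟩ := hr₂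
    obtain ⟨hc, hle'⟩ := hcomb _ _ t₁ t₂ ht₁ ht₂ hc₁ hc₂
    have heq : (u₁ : N) + A d₁ + (u₂ + A d₂) = ((u₁ + u₂ : V) : N) + A (d₁ + d₂) := by
      simp only [Submodule.coe_add, map_add]; abel
    rw [heq] at hc hle'
    have := hle (u₁ + u₂) _ ⟨_, by positivity, d₁ + d₂, T.add_mem hd₁ hd₂, hc, rfl⟩
    rw [map_add p] at this
    linarith
  have hsmul_le : ∀ c : ℝ, 0 < c → ∀ u, m (c • u) ≤ c * m u := by
    intro c hc u
    rw [← div_le_iff₀' hc]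
    refine le_csInf (hne u) ?_
    rintro _ ⟨t, ht, d, hd, hcm, rfl⟩
    rw [div_le_iff₀' hc]
    have heq : (t / c) • (((c • u : V) : N) + A (c • d)) = t • ((u : N) + A d) := by
      simp only [Submodule.coe_smul, map_smul, ← smul_add, smul_smul]
      congr 1
      field_simp
    refine hle _ _ ⟨t / c, by positivity, c • d, T.smul_mem hc.le hd,
      by rwa [heq], ?_⟩
    rw [heq, map_smul, smul_eq_mul]
    field_simp
  have hsmul : ∀ c : ℝ, 0 < c → ∀ u, m (c • u) = c * m u := by
    intro c hc u
    refine le_antisymm (hsmul_le c hc u) ?_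
    have := hsmul_le c⁻¹ (by positivity) (c • u)
    rw [smul_smul, inv_mul_cancel₀ hc.ne', one_smul] at this
    rwa [← div_eq_inv_mul, le_div_iff₀' hc] at this
  have hzero : 0 ≤ m 0 := by
    have := hsmul 2 two_pos 0
    rw [smul_zero] at this
    linarith
  obtain ⟨v₀, -, hv₀⟩ := exists_extension_of_le_sublinear (⟨⊥, 0⟩ : V →ₗ.[ℝ] ℝ) m hsmul hadd
    (fun ⟨x, hx⟩ => by
      obtain rfl := (Submodule.mem_bot ℝ).1 hx
      simpa using hzero)
  obtain ⟨v, hv⟩ := LinearMap.exists_extend v₀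
  have hvV : ∀ u : V, v u = v₀ u := fun u => LinearMap.congr_fun hv u
  refine ⟨v, fun u hu hc => ?_, fun d hd => ?_⟩
  · rw [hvV ⟨u, hu⟩]
    exact (hv₀ _).trans (hle _ _ ⟨1, one_pos, 0, T.zero_mem, by simpa using hc, by simp⟩)
  · have := (hv₀ (-⟨A d, hT d hd⟩)).trans
      (hle _ (-p d) ⟨1, one_pos, d, hd, by simpa using ha, by simp⟩)
    rw [← hvV] at this
    simp only [Submodule.coe_neg, map_neg] at this
    linarith

lemma exists_add_smul_mem_of_mem_intrinsicInterior
    {X : Type*} [NormedAddCommGroup X] [InnerProductSpace ℝ X]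
    {s : Set X} {x u : X} (hx : x ∈ intrinsicInterior ℝ s)
    (hu : u ∈ vectorSpan ℝ s) : ∃ t : ℝ, 0 < t ∧ x + t • u ∈ s := by
  obtain ⟨y, hy, rfl⟩ := hx
  have hmem : ∀ t : ℝ, (y : X) + t • u ∈ affineSpan ℝ s := fun t => by
    rw [add_comm]
    refine AffineSubspace.vadd_mem_of_mem_direction ?_ y.2
    rw [direction_affineSpan]
    exact Submodule.smul_mem _ _ hu
  have hcont : Continuous fun t : ℝ => (⟨(y : X) + t • u, hmem t⟩ : affineSpan ℝ s) := by
    fun_prop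
  have hev : ∀ᶠ t : ℝ in 𝓝 0, (y : X) + t • u ∈ s := by
    refine hcont.continuousAt.eventually (p := fun z : affineSpan ℝ s => (z : X) ∈ s) ?_
    have h0 : (⟨(y : X) + (0 : ℝ) • u, hmem 0⟩ : affineSpan ℝ s) = y := by simp
    beta_reduce
    rw [h0]
    exact mem_interior_iff_mem_nhds.1 hy
  have hev' : ∀ᶠ t : ℝ in 𝓝[>] 0, (y : X) + t • u ∈ s := hev.filter_mono nhdsWithin_le_nhds
  obtain ⟨t, ht, hpos⟩ := (hev'.and self_mem_nhdsWithin).exists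
  exact ⟨t, hpos, ht⟩

lemma coe_toReal_of_mem_edom {X : Type*}
    {f : X → EReal} (hf : ProperFn f) {x : X} (hx : x ∈ edom f) :
    ((f x).toReal : EReal) = f x :=
  EReal.coe_toReal hx (hf.1 x)

lemma ConvexFn.convexOn_toReal {X : Type*} [NormedAddCommGroup X] [InnerProductSpace ℝ X]
    {f : X → EReal} (hf : ConvexFn f) (hp : ProperFn f) :
    ConvexOn ℝ (edom f) fun x => (f x).toReal := by
  have key : ∀ ⦃x⦄, x ∈ edom f → ∀ ⦃y⦄, y ∈ edom f → ∀ ⦃a b : ℝ⦄, 0 ≤ a → 0 ≤ b → a + b = 1 →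
      f (a • x + b • y) ≤ ((a * (f x).toReal + b * (f y).toReal : ℝ) : EReal) := by
    intro x hx y hy a b ha hb hab
    have h := hf x y a b ha hb hab
    rw [← coe_toReal_of_mem_edom hp hx, ← coe_toReal_of_mem_edom hp hy] at h
    exact_mod_cast h
  have hconv : Convex ℝ (edom f) := fun x hx y hy a b ha hb hab =>
    ((key hx hy ha hb hab).trans_lt (EReal.coe_lt_top _)).ne
  refine ⟨hconv, fun x hx y hy a b ha hb hab => ?_⟩
  have h := key hx hy ha hb hab
  rw [← coe_toReal_of_mem_edom hp (hconv hx hy ha hb hab)] at h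
  exact_mod_cast h

lemma mem_subdiff_iff {X : Type*} [NormedAddCommGroup X] [InnerProductSpace ℝ X]
    {f : X → EReal} (hp : ProperFn f) {w v : X} (hw : w ∈ edom f) :
    v ∈ subdiff f w ↔ ∀ y ∈ edom f, ⟪v, y - w⟫ ≤ (f y).toReal - (f w).toReal := by
  have key : ∀ y ∈ edom f, (f w + ((⟪v, y - w⟫ - 0 : ℝ) : EReal) ≤ f y ↔
      ⟪v, y - w⟫ ≤ (f y).toReal - (f w).toReal) := fun y hy => by
    rw [← coe_toReal_of_mem_edom hp hw, ← coe_toReal_of_mem_edom hp hy]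
    norm_cast
    rw [sub_zero, le_sub_iff_add_le']
    rfl
  refine ⟨fun h y hy => (key y hy).1 (h.2 y), fun h => ⟨hw, fun y => ?_⟩⟩
  by_cases hy : y ∈ edom f
  · exact (key y hy).2 (h y hy)
  · rw [not_not.1 hy]
    exact le_top

lemma mem_subdiff_indicatorFn {X : Type*} [NormedAddCommGroup X] [InnerProductSpace ℝ X]
    {S : Set X} {x w : X} (hx : x ∈ S)
    (hw : ∀ y ∈ S, ⟪w, y - x⟫ ≤ 0) : w ∈ subdiff (indicatorFn S) x := by
  refine ⟨by simp [indicatorFn, hx], fun y => ?_⟩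
  by_cases hy : y ∈ S
  · simpa [indicatorFn, hx, hy] using hw y hy
  · simp [indicatorFn, hy]

/-- The Riesz representative of a linear functional on a finite-dimensional space. -/
lemma exists_inner_eq (q : E →ₗ[ℝ] ℝ) : ∃ v : E, ∀ x, ⟪v, x⟫ = q x :=
  ⟨(InnerProductSpace.toDual ℝ E).symm (LinearMap.toContinuousLinearMap q), fun x => by
    rw [InnerProductSpace.toDual_symm_apply]
    rfl⟩

lemma subdiff_nonempty_of_mem_intrinsicInterior {f : E → EReal} (hp : ProperFn f)
    (hf : ConvexFn f) {w : E} (hw : w ∈ intrinsicInterior ℝ (edom f)) :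
    (subdiff f w).Nonempty := by
  have hwd : w ∈ edom f := intrinsicInterior_subset hw
  obtain ⟨q, hq, -⟩ := exists_subgradient_dominating (hf.convexOn_toReal hp) hwd
    (vectorSpan ℝ (edom f)) (fun u hu => exists_add_smul_mem_of_mem_intrinsicInterior hw hu)
    (0 : E →ₗ[ℝ] E) 0 ⊤ (by simp) (by simp)
  obtain ⟨v, hv⟩ := exists_inner_eq q
  refine ⟨v, (mem_subdiff_iff hp hwd).2 fun y hy => ?_⟩
  rw [hv]
  simpa using hq (y - w) (vsub_mem_vectorSpan ℝ hy hwd) (by simpa using hy)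

/-- Inside a subspace `W` of directions, the feasible directions of `S` at `x` are given by finitely
many linear inequalities. -/
def LocallyPolyhedralAt (S : Set E) (x : E) : Prop :=
  ∃ (W : Submodule ℝ E) (ι : Type) (s : Finset ι) (ψ : ι → E →ₗ[ℝ] ℝ),
    (∀ y ∈ S, y - x ∈ W ∧ ∀ i ∈ s, ψ i (y - x) ≤ 0) ∧
    ∀ d ∈ W, (∀ i ∈ s, ψ i d ≤ 0) → ∃ t : ℝ, 0 < t ∧ x + t • d ∈ S

lemma locallyPolyhedralAt_of_mem_intrinsicInterior
    {X : Type*} [NormedAddCommGroup X] [InnerProductSpace ℝ X]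
    {S : Set X} {x : X}
    (hx : x ∈ intrinsicInterior ℝ S) : LocallyPolyhedralAt S x :=
  ⟨vectorSpan ℝ S, Empty, ∅, fun _ => 0,
    fun _ hy => ⟨vsub_mem_vectorSpan ℝ hy (intrinsicInterior_subset hx), by simp⟩,
    fun _ hd _ => exists_add_smul_mem_of_mem_intrinsicInterior hx hd⟩

lemma IsPolyhedral.locallyPolyhedralAt {X : Type*} [NormedAddCommGroup X] [InnerProductSpace ℝ X]
    {S : Set X} (hS : IsPolyhedral S) {x : X} (hx : x ∈ S) :
    LocallyPolyhedralAt S x := by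
  classical
  obtain ⟨m, φ, c, rfl⟩ := hS
  refine ⟨⊤, Fin m, Finset.univ.filter fun i => φ i x = c i, fun i => φ i, fun y hy =>
    ⟨trivial, fun i hi => ?_⟩, fun d _ hd => ?_⟩
  · have := hy i
    simp only [Finset.mem_filter, Finset.mem_univ, true_and] at hi
    simp only [ContinuousLinearMap.coe_coe, map_sub, hi]
    linarith
  · have hev : ∀ᶠ t : ℝ in 𝓝[>] 0, ∀ i, φ i (x + t • d) ≤ c i := by
      refine eventually_all.2 fun i => ?_
      rcases (hx i).eq_or_lt with hi | hi
      · filter_upwards [self_mem_nhdsWithin] with t ht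
        have := hd i (by simpa using hi)
        simp only [ContinuousLinearMap.coe_coe] at this
        rw [map_add, map_smul, hi, smul_eq_mul]
        nlinarith [mem_Ioi.1 ht]
      · have hcont : Continuous fun t : ℝ => φ i (x + t • d) := by fun_prop
        refine Filter.Eventually.filter_mono nhdsWithin_le_nhds ?_
        filter_upwards [hcont.continuousAt.eventually_lt continuousAt_const
          (show φ i (x + (0 : ℝ) • d) < c i by simpa using hi)] with t ht using ht.le
    obtain ⟨t, ht, hpos⟩ := (hev.and self_mem_nhdsWithin).exists
    exact ⟨t, hpos, ht⟩

/-- Subdifferential sum and chain rule for `g ∘ A + ι_S` at a point where `S` is locally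
polyhedral and which `A` maps into the relative interior of the domain of `g`. -/
lemma exists_subdiff_decomposition {S : Set E} {g : F → EReal} (hp : ProperFn g)
    (hg : ConvexFn g) (hS : Convex ℝ S) (A : E →L[ℝ] F) {x p : E} (hx : x ∈ S)
    (hloc : LocallyPolyhedralAt S x) (hAx : A x ∈ intrinsicInterior ℝ (edom g))
    (hpx : ∀ y ∈ S, A y ∈ edom g → ⟪p, y - x⟫ ≤ (g (A y)).toReal - (g (A x)).toReal) :
    ∃ v ∈ subdiff g (A x), ∃ w ∈ subdiff (indicatorFn S) x,
      p = ContinuousLinearMap.adjoint A v + w := by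
  obtain ⟨W, ι, s, ψ, hSψ, hψS⟩ := hloc
  have hgc := hg.convexOn_toReal hp
  have hAd : A x ∈ edom g := intrinsicInterior_subset hAx
  set V := vectorSpan ℝ (edom g)
  let M : Submodule ℝ E := W ⊓ V.comap (A : E →ₗ[ℝ] F)
  let T : PointedCone ℝ E :=
    { carrier := {d | d ∈ M ∧ ∀ i ∈ s, ψ i d ≤ 0}
      add_mem' := fun {a b} ha hb => ⟨M.add_mem ha.1 hb.1, fun i hi => by
        rw [map_add]; linarith [ha.2 i hi, hb.2 i hi]⟩
      zero_mem' := ⟨M.zero_mem, fun i _ => by simp⟩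
      smul_mem' := fun c d hd => ⟨M.smul_mem (c : ℝ) hd.1, fun i hi => by
        have : ψ i ((c : ℝ) • d) ≤ 0 := by
          rw [map_smul]
          exact mul_nonpos_of_nonneg_of_nonpos c.2 (hd.2 i hi)
        exact this⟩ }
  obtain ⟨v₀, hv₀, hv₀T⟩ := exists_subgradient_dominating hgc hAd V
    (fun u hu => exists_add_smul_mem_of_mem_intrinsicInterior hAx hu) (A : E →ₗ[ℝ] F)
    (innerSL ℝ p : E →ₗ[ℝ] ℝ) T (fun d hd => hd.1.2) (by
      intro d hd τ hτ hmem
      simp only [ContinuousLinearMap.coe_coe, innerSL_apply_apply] at hmem ⊢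
      obtain ⟨t, ht, htS⟩ := hψS d hd.1.1 hd.2
      set σ := min t τ
      have hσ0 : 0 < σ := lt_min ht hτ
      have hσS : x + σ • d ∈ S := by
        have := hS.add_smul_mem hx htS (t := σ / t)
          ⟨by positivity, (div_le_one ht).2 (min_le_left _ _)⟩
        rwa [smul_smul, div_mul_cancel₀ _ ht.ne'] at this
      have hστ : σ / τ ≤ 1 := (div_le_one hτ).2 (min_le_right _ _)
      have heq : (1 - σ / τ) • A x + (σ / τ) • (A x + τ • A d) = A (x + σ • d) := by
        rw [map_add, map_smul]
        match_scalars <;> field_simp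
        ring
      have hin := hgc.1 hAd hmem (sub_nonneg.2 hστ) (by positivity) (sub_add_cancel _ _)
      have hle := hgc.2 hAd hmem (sub_nonneg.2 hστ) (by positivity) (sub_add_cancel _ _)
      rw [heq] at hin
      simp only [heq, smul_eq_mul] at hle
      have h1 := hpx _ hσS hin
      rw [add_sub_cancel_left, inner_smul_right] at h1
      have h2 : σ * ⟪p, d⟫ ≤
          σ / τ * ((g (A x + τ • A d)).toReal - (g (A x)).toReal) := by linarith
      rw [div_mul_eq_mul_div, mul_div_assoc] at h2
      have := le_of_mul_le_mul_left h2 hσ0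
      rwa [le_div_iff₀' hτ] at this)
  obtain ⟨c, hc, hcsum⟩ := farkas s (fun i => ψ i ∘ₗ M.subtype)
    (((innerSL ℝ p : E →ₗ[ℝ] ℝ) - v₀ ∘ₗ (A : E →ₗ[ℝ] F)) ∘ₗ M.subtype) (fun d hd => by
      have := hv₀T d ⟨d.2, hd⟩
      simpa using this)
  obtain ⟨χ, η, hχ, hη, hsplit⟩ := exists_split_of_eq_zero_on_inf_comap (A : E →ₗ[ℝ] F) W V
    ((innerSL ℝ p : E →ₗ[ℝ] ℝ) - v₀ ∘ₗ (A : E →ₗ[ℝ] F) - ∑ i ∈ s, c i • ψ i) (fun d hdW hdV => by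
      have := LinearMap.congr_fun hcsum ⟨d, hdW, hdV⟩
      simp only [LinearMap.comp_apply, Submodule.subtype_apply, LinearMap.sum_apply,
        LinearMap.smul_apply] at this
      rw [LinearMap.sub_apply, this]
      simp)
  obtain ⟨v, hv⟩ := exists_inner_eq (v₀ + η)
  obtain ⟨w, hw⟩ := exists_inner_eq (χ + ∑ i ∈ s, c i • ψ i)
  refine ⟨v, (mem_subdiff_iff hp hAd).2 fun y hy => ?_, w,
    mem_subdiff_indicatorFn hx fun y hy => ?_, ext_inner_right ℝ fun d => ?_⟩
  · have hyV : y - A x ∈ V := vsub_mem_vectorSpan ℝ hy hAd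
    rw [hv, LinearMap.add_apply, hη _ hyV, add_zero]
    simpa using hv₀ (y - A x) hyV (by simpa using hy)
  · obtain ⟨hyW, hyψ⟩ := hSψ y hy
    rw [hw, LinearMap.add_apply, hχ _ hyW, zero_add, LinearMap.sum_apply]
    exact Finset.sum_nonpos fun i hi => mul_nonpos_of_nonneg_of_nonpos (hc i hi) (hyψ i hi)
  · rw [inner_add_left, ContinuousLinearMap.adjoint_inner_left, hv, hw]
    have := hsplit d
    simp only [LinearMap.sub_apply, LinearMap.comp_apply, ContinuousLinearMap.coe_coe,
      innerSL_apply_apply] at this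
    simp only [LinearMap.add_apply]
    linarith

/-- First-order condition satisfied by Fréchet stationary points of the fractional program after
linearizing the smooth part and the denominator. -/
lemma inner_le_of_frechet_stationary
    {S : Set E} {g : F → EReal} {h : E → ℝ} {f : G → EReal} {A : E →L[ℝ] F} {K : E →L[ℝ] G}
    (hS : Convex ℝ S) (hgp : ProperFn g) (hg : ConvexFn g) (hfp : ProperFn f) (hf : ConvexFn f)
    (hfS : ∀ x ∈ S, K x ∈ edom f) (hfpos : ∀ x ∈ S, 0 < f (K x)) {x h₀ : E} (hx : x ∈ S)
    (hAx : A x ∈ edom g) (hh : HasGradientAt h h₀ x)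
    (hnn : 0 ≤ (g (A x)).toReal + h x)
    (hstat : (0 : E) ∈ frechetSubdiff
      (fun x => (g (A x) + (h x : EReal) + indicatorFn S x) / f (K x)) x)
    {s : G} (hs : s ∈ subdiff f (K x)) {y : E} (hy : y ∈ S) (hAy : A y ∈ edom g) :
    ⟪(((g (A x)).toReal + h x) / (f (K x)).toReal) • ContinuousLinearMap.adjoint K s - h₀, y - x⟫
      ≤ (g (A y)).toReal - (g (A x)).toReal := by
  have hgc := hg.convexOn_toReal hgp
  have hfc := hf.convexOn_toReal hfp
  have hDpos : ∀ z ∈ S, 0 < (f (K z)).toReal := fun z hz =>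
    EReal.toReal_pos (hfpos z hz) (hfS z hz)
  set θ := ((g (A x)).toReal + h x) / (f (K x)).toReal with hθ
  have hθ0 : 0 ≤ θ := div_nonneg hnn (hDpos x hx).le
  have hval : ∀ z ∈ S, A z ∈ edom g →
      (g (A z) + (h z : EReal) + indicatorFn S z) / f (K z)
        = ((((g (A z)).toReal + h z) / (f (K z)).toReal : ℝ) : EReal) := fun z hz hAz => by
    rw [EReal.coe_div, EReal.coe_add, coe_toReal_of_mem_edom hgp hAz,
      coe_toReal_of_mem_edom hfp (hfS z hz), indicatorFn, if_pos hz, add_zero]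
  set d := y - x with hd
  set M := max (f (K x)).toReal (f (K y)).toReal
  have hz : ∀ t : ℝ, x + t • d = (1 - t) • x + t • y := fun t => by
    rw [hd]; module
  have hline : Tendsto (fun t : ℝ => x + t • d) (𝓝[>] 0) (𝓝 x) := by
    have hcont : Continuous fun t : ℝ => x + t • d := by fun_prop
    simpa using (hcont.tendsto 0).mono_left nhdsWithin_le_nhds
  have hder : Tendsto (fun t : ℝ => t⁻¹ * (h (x + t • d) - h x)) (𝓝[>] 0) (𝓝 ⟪h₀, d⟫) := by
    have := (hh.hasFDerivAt.hasLineDerivAt d).tendsto_slope_zero_right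
    simpa using this
  have hkey : ∀ ε : ℝ, 0 < ε →
      θ * ⟪s, K d⟫ - ε * ‖d‖ * M - ((g (A y)).toReal - (g (A x)).toReal) ≤ ⟪h₀, d⟫ := by
    intro ε hε
    refine ge_of_tendsto hder ?_
    filter_upwards [hline.eventually (hstat.2 ε hε), self_mem_nhdsWithin,
      Ioc_mem_nhdsGT (zero_lt_one' ℝ)] with t hstat_t (ht : 0 < t) ht1
    have h1t : 0 ≤ 1 - t := sub_nonneg.2 ht1.2
    have hzS : x + t • d ∈ S := by
      rw [hz]; exact hS hx hy h1t ht.le (sub_add_cancel _ _)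
    have hAz : A (x + t • d) = (1 - t) • A x + t • A y := by rw [hz]; simp
    have hKz : K (x + t • d) = (1 - t) • K x + t • K y := by rw [hz]; simp
    have hAzd : A (x + t • d) ∈ edom g := by
      rw [hAz]; exact hgc.1 hAx hAy h1t ht.le (sub_add_cancel _ _)
    have hN := hgc.2 hAx hAy h1t ht.le (sub_add_cancel _ _)
    have hD := hfc.2 (hfS x hx) (hfS y hy) h1t ht.le (sub_add_cancel _ _)
    simp only [← hAz, ← hKz, smul_eq_mul] at hN hD
    have hDM : (f (K (x + t • d))).toReal ≤ M := by
      have h₁ : (f (K x)).toReal ≤ M := le_max_left _ _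
      have h₂ : (f (K y)).toReal ≤ M := le_max_right _ _
      nlinarith
    have hDs := (mem_subdiff_iff hfp (hfS x hx)).1 hs _ (hfS _ hzS)
    rw [← map_sub, add_sub_cancel_left, map_smul, inner_smul_right] at hDs
    rw [hval x hx hAx, hval _ hzS hAzd, ← EReal.coe_add, EReal.coe_le_coe_iff, ← hθ,
      inner_zero_left, add_sub_cancel_left, norm_smul, Real.norm_of_nonneg ht.le,
      le_div_iff₀ (hDpos _ hzS)] at hstat_t
    have hθx : θ * (f (K x)).toReal = (g (A x)).toReal + h x :=
      div_mul_cancel₀ _ (hDpos x hx).ne'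
    have e1 := mul_le_mul_of_nonneg_left hDs hθ0
    have e2 : ε * (t * ‖d‖) * (f (K (x + t • d))).toReal ≤ ε * (t * ‖d‖) * M :=
      mul_le_mul_of_nonneg_left hDM (by positivity)
    rw [← div_eq_inv_mul, le_div_iff₀ ht]
    nlinarith
  have hlim : Tendsto (fun ε : ℝ => θ * ⟪s, K d⟫ - ε * ‖d‖ * M
      - ((g (A y)).toReal - (g (A x)).toReal)) (𝓝[>] 0)
      (𝓝 (θ * ⟪s, K d⟫ - ((g (A y)).toReal - (g (A x)).toReal))) := by
    have hcont : Continuous fun ε : ℝ => θ * ⟪s, K d⟫ - ε * ‖d‖ * M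
      - ((g (A y)).toReal - (g (A x)).toReal) := by fun_prop
    simpa using (hcont.tendsto 0).mono_left nhdsWithin_le_nhds
  have := le_of_tendsto hlim (eventually_mem_nhdsWithin.mono fun ε hε => hkey ε hε)
  rw [inner_sub_left, real_inner_smul_left, ContinuousLinearMap.adjoint_inner_left]
  linarith

/-- a Fréchet stationary point is a limiting lifted stationary point
under constraint qualifications. -/
theorem frechet_stationary_implies_limiting_lifted
    (S : Set E) (g : F → EReal) (h : E → ℝ) (h' : E → E) (Lh : ℝ)
    (f : G → EReal) (A : E →L[ℝ] F) (K : E →L[ℝ] G)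
    (hA1 : Assumption1 S g h h' Lh f A K)
    (xb : E)
    (hstat : (0 : E) ∈ frechetSubdiff
        (fun x => (g (A x) + (h x : EReal) + indicatorFn S x) / f (K x)) xb)
    (hKdom : K xb ∈ interior (edom f))
    (hqual : (xb ∈ intrinsicInterior ℝ S ∧ A xb ∈ intrinsicInterior ℝ (edom g)) ∨
             (IsPolyhedral S ∧ xb ∈ S ∧ A xb ∈ intrinsicInterior ℝ (edom g))) :
    ∃ v ∈ subdiff g (A xb), ∃ w ∈ subdiff (indicatorFn S) xb, ∃ s ∈ subdiff f (K xb),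
      (f (K xb)).toReal • (ContinuousLinearMap.adjoint A v + h' xb + w)
        - ((g (A xb)).toReal + h xb) • (ContinuousLinearMap.adjoint K s) = 0 := by
  obtain ⟨-, hS, -, hgp, hg, -, ⟨O, -, hSO, hgrad, -⟩, hfp, hf, -, hfint, hfpos, -, α, hα, hαle⟩ :=
    hA1
  have hx : xb ∈ S := hqual.elim (fun h => intrinsicInterior_subset h.1) fun h => h.2.1
  have hAint : A xb ∈ intrinsicInterior ℝ (edom g) := hqual.elim (fun h => h.2) fun h => h.2.2
  have hAx : A xb ∈ edom g := intrinsicInterior_subset hAint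
  have hloc : LocallyPolyhedralAt S xb :=
    hqual.elim (fun h => locallyPolyhedralAt_of_mem_intrinsicInterior h.1)
      fun h => h.1.locallyPolyhedralAt hx
  have hnn : 0 ≤ (g (A xb)).toReal + h xb := by
    have := hαle xb hx
    rw [← coe_toReal_of_mem_edom hgp hAx] at this
    exact hα.le.trans (by exact_mod_cast this)
  have hDpos : 0 < (f (K xb)).toReal :=
    EReal.toReal_pos (hfpos xb hx) (interior_subset hKdom)
  obtain ⟨s, hs⟩ := subdiff_nonempty_of_mem_intrinsicInterior hfp hf
    (interior_subset_intrinsicInterior hKdom)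
  obtain ⟨v, hv, w, hw, heq⟩ := exists_subdiff_decomposition hgp hg hS A hx hloc hAint
    fun y hy hAy => inner_le_of_frechet_stationary hS hgp hg hfp hf
      (fun x hx => interior_subset (hfint x hx)) hfpos hx hAx (hgrad xb (hSO hx)) hnn hstat hs hy
      hAy
  refine ⟨v, hv, w, hw, s, hs, ?_⟩
  rw [add_right_comm, ← heq, sub_add_cancel, smul_smul, mul_div_cancel₀ _ hDpos.ne', sub_self]

end FracPaper
end
end

section
/- Consider the one-dimensional fractional problem min_{x∈[−1,1]} (x²+1)/(|x|+1), i.e., S = [−1,1], g ≡ 0, h(x) = x²+1, f(x) = |x|+1 and A = K = id on ℝ. Then: (a) the point x̄ = 0 is a limiting lifted stationary point, and in fact (2x̄ + ∂ι_{[−1,1]}(x̄))·(|x̄|+1) − (x̄²+1)·∂(|·|+1)(x̄) = [−1,1]; (b) x̄ = 0 is not a Fréchet stationary point, since the Fréchet subdifferential of x ↦ (x²+1+ι_{[−1,1]}(x))/(|x|+1) at 0 is empty. -/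
open Set Filter Topology Metric

open scoped RealInnerProductSpace

noncomputable section

namespace FracPaper

variable {E : Type*} [NormedAddCommGroup E] [InnerProductSpace ℝ E] [FiniteDimensional ℝ E]
variable {F : Type*} [NormedAddCommGroup F] [InnerProductSpace ℝ F] [FiniteDimensional ℝ F]
variable {G : Type*} [NormedAddCommGroup G] [InnerProductSpace ℝ G] [FiniteDimensional ℝ G]

/-- At an interior point of `S`, the subdifferential of the indicator function is `{0}`. -/
theorem subdiff_indicatorFn_of_mem_interior {S : Set ℝ} {x : ℝ} (hx : x ∈ interior S) :
    subdiff (indicatorFn S) x = {0} := by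
  have hxS : x ∈ S := interior_subset hx
  ext w
  simp only [mem_singleton_iff]
  constructor
  · rintro ⟨-, hw⟩
    obtain ⟨r, hr, hrS⟩ := Metric.isOpen_iff.1 isOpen_interior x hx
    have key : ∀ y ∈ S, w * (y - x) ≤ 0 := by
      intro y hy
      have h := hw y
      simp only [indicatorFn, if_pos hxS, if_pos hy, zero_add, sub_zero,
        RCLike.inner_apply, conj_trivial] at h
      have h' : (y - x) * w ≤ 0 := by exact_mod_cast h
      linarith
    have mem : ∀ s : ℝ, |s| < r → x + s ∈ S := fun s hs =>
      interior_subset (hrS (by simpa [Metric.mem_ball, Real.dist_eq] using hs))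
    have h₁ := key _ (mem (r / 2) (by rw [abs_of_pos (by positivity)]; linarith))
    have h₂ := key _ (mem (-(r / 2)) (by rw [abs_neg, abs_of_pos (by positivity)]; linarith))
    rw [add_sub_cancel_left] at h₁ h₂
    apply le_antisymm <;> nlinarith
  · rintro rfl
    refine ⟨by simp [indicatorFn, hxS], fun y => ?_⟩
    by_cases hy : y ∈ S <;> simp [indicatorFn, hxS, hy]

/-- The subdifferential of `t ↦ |t| + c` at the origin is `[-1, 1]`. -/
theorem subdiff_abs_add_const_zero (c : ℝ) :
    subdiff (fun t : ℝ => ((|t| + c : ℝ) : EReal)) 0 = Icc (-1 : ℝ) 1 := by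
  have iff_real (s y : ℝ) : ((|(0 : ℝ)| + c : ℝ) : EReal) + ((⟪s, y - 0⟫ - 0 : ℝ) : EReal) ≤
      ((|y| + c : ℝ) : EReal) ↔ y * s ≤ |y| := by
    rw [← EReal.coe_add, EReal.coe_le_coe_iff]
    simp only [abs_zero, sub_zero, RCLike.inner_apply, conj_trivial]
    constructor <;> intro h <;> linarith
  ext s
  constructor
  · rintro ⟨-, hs⟩
    have h₁ := (iff_real s 1).1 (hs 1)
    have h₂ := (iff_real s (-1)).1 (hs (-1))
    rw [abs_neg] at h₂
    rw [abs_one] at h₁ h₂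
    constructor <;> linarith
  · intro hs
    refine ⟨EReal.coe_ne_top _, fun y => (iff_real s y).2 ?_⟩
    calc y * s ≤ |y * s| := le_abs_self _
      _ = |y| * |s| := abs_mul _ _
      _ ≤ |y| := mul_le_of_le_one_right (abs_nonneg _) (abs_le.2 hs)

/-- The Fréchet subdifferential of a function which decreases at a linear rate in both
directions is empty. -/
theorem frechetSubdiff_eq_empty_of_le_sub_mul_abs {f : ℝ → EReal} {φ : ℝ → ℝ} {x c : ℝ}
    (hc : 0 < c) (hf : ∀ᶠ y in 𝓝 x, f y = φ y) (hφ : ∀ᶠ y in 𝓝 x, φ y ≤ φ x - c * |y - x|) :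
    frechetSubdiff f x = ∅ := by
  refine eq_empty_iff_forall_notMem.2 ?_
  rintro v ⟨-, hv⟩
  obtain ⟨r, hr, hball⟩ := Metric.eventually_nhds_iff.1 ((hv (c / 2) (by positivity)).and
    (hf.and hφ))
  have key : ∀ s : ℝ, |s| < r → s * v + c / 2 * |s| ≤ 0 := by
    intro s hs
    obtain ⟨h, hfy, hφy⟩ := hball (y := x + s) (by simpa [Real.dist_eq] using hs)
    rw [hf.self_of_nhds, hfy, ← EReal.coe_add, EReal.coe_le_coe_iff] at h
    simp only [add_sub_cancel_left, RCLike.inner_apply, conj_trivial, Real.norm_eq_abs] at h hφy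
    linarith
  have habs : |r / 2| = r / 2 := abs_of_pos (by positivity)
  have h₁ := key (r / 2) (by rw [habs]; linarith)
  have h₂ := key (-(r / 2)) (by rw [abs_neg, habs]; linarith)
  rw [abs_neg] at h₂
  rw [habs] at h₁ h₂
  nlinarith [mul_pos hc hr]

/-- the one-dimensional example `min (x²+1)/(|x|+1)` over `[-1,1]`:
`0` is a limiting lifted stationary point but not a Fréchet stationary point. -/
theorem example_lifted_not_frechet :
    ((0 : ℝ) ∈ {r : ℝ | ∃ w ∈ subdiff (indicatorFn (Icc (-1 : ℝ) 1)) 0,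
        ∃ s ∈ subdiff (fun t : ℝ => ((|t| + 1 : ℝ) : EReal)) 0,
        r = (2 * 0 + w) * (|(0 : ℝ)| + 1) - ((0 : ℝ) ^ 2 + 1) * s}) ∧
    ({r : ℝ | ∃ w ∈ subdiff (indicatorFn (Icc (-1 : ℝ) 1)) 0,
        ∃ s ∈ subdiff (fun t : ℝ => ((|t| + 1 : ℝ) : EReal)) 0,
        r = (2 * 0 + w) * (|(0 : ℝ)| + 1) - ((0 : ℝ) ^ 2 + 1) * s} = Icc (-1 : ℝ) 1) ∧
    frechetSubdiff (fun t : ℝ =>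
        (((t ^ 2 + 1 : ℝ) : EReal) + indicatorFn (Icc (-1 : ℝ) 1) t) /
          ((|t| + 1 : ℝ) : EReal)) 0 = ∅ := by
  have hset : {r : ℝ | ∃ w ∈ subdiff (indicatorFn (Icc (-1 : ℝ) 1)) 0,
      ∃ s ∈ subdiff (fun t : ℝ => ((|t| + 1 : ℝ) : EReal)) 0,
      r = (2 * 0 + w) * (|(0 : ℝ)| + 1) - ((0 : ℝ) ^ 2 + 1) * s} = Icc (-1 : ℝ) 1 := by
    rw [subdiff_indicatorFn_of_mem_interior (by rw [interior_Icc]; norm_num),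
      subdiff_abs_add_const_zero]
    ext r
    simp only [mem_ofPred_eq, mem_singleton_iff, exists_eq_left]
    constructor
    · rintro ⟨s, hs, rfl⟩
      constructor <;> norm_num <;> linarith [hs.1, hs.2]
    · intro hr
      exact ⟨-r, ⟨by linarith [hr.2], by linarith [hr.1]⟩, by norm_num⟩
  refine ⟨hset.symm.subset (by norm_num), hset, ?_⟩
  refine frechetSubdiff_eq_empty_of_le_sub_mul_abs (φ := fun t => (t ^ 2 + 1) / (|t| + 1))
    (c := 1 / 4) (by norm_num) ?_ ?_
  · filter_upwards [Icc_mem_nhds (show (-1 : ℝ) < 0 by norm_num) one_pos] with t ht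
    rw [indicatorFn, if_pos ht, add_zero, ← EReal.coe_div]
  · filter_upwards [Metric.ball_mem_nhds (0 : ℝ) (show (0 : ℝ) < 1 / 2 by norm_num)] with t ht
    rw [Metric.mem_ball, Real.dist_eq, sub_zero] at ht
    have h₀ := abs_nonneg t
    rw [div_le_iff₀ (by positivity)]
    norm_num
    nlinarith [sq_abs t]

end FracPaper
end
end

section
/- Let g : ℝˢ → ℝ ∪ {+∞} be proper, convex and lower semicontinuous, let w ∈ ℝˢ with ∂g(w) ≠ ∅, let γ > 0, and let z := prox_{g*, 1/γ}(w/γ), i.e., z is the unique minimizer of ζ ↦ g*(ζ) − ⟨ζ, w⟩ + (γ/2)‖ζ‖². Then ‖z‖ ≤ ‖z̃‖ for every z̃ ∈ ∂g(w). -/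
open Set Filter Topology Metric

open scoped RealInnerProductSpace

noncomputable section

namespace FracPaper

variable {E : Type*} [NormedAddCommGroup E] [InnerProductSpace ℝ E] [FiniteDimensional ℝ E]
variable {F : Type*} [NormedAddCommGroup F] [InnerProductSpace ℝ F] [FiniteDimensional ℝ F]
variable {G : Type*} [NormedAddCommGroup G] [InnerProductSpace ℝ G] [FiniteDimensional ℝ G]

/-- The Fenchel–Young inequality at a point where `g` takes a real value. -/
lemma le_conj_of_eq_coe {g : F → EReal} {w : F} {r : ℝ} (hr : g w = r) (v : F) :
    ((⟪v, w⟫ - r : ℝ) : EReal) ≤ conj g v := by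
  have h := le_iSup (fun x : F => ((⟪v, x⟫ : EReal) - g x)) w
  simpa [conj, hr] using h

/-- Equality case of Fenchel–Young: a subgradient bounds the conjugate from above. -/
lemma conj_le_of_mem_subdiff {g : F → EReal} {w v : F} {r : ℝ} (hr : g w = r)
    (hv : v ∈ subdiff g w) : conj g v ≤ ((⟪v, w⟫ - r : ℝ) : EReal) := by
  refine iSup_le fun x => ?_
  have h := hv.2 x
  rw [hr] at h
  induction hx : g x with
  | bot =>
    rw [hx, ← EReal.coe_add] at h
    exact absurd (le_bot_iff.mp h) (EReal.coe_ne_bot _)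
  | top => simp
  | coe s =>
    rw [hx, ← EReal.coe_add, EReal.coe_le_coe_iff, inner_sub_right] at h
    rw [← EReal.coe_sub, EReal.coe_le_coe_iff]
    linarith

/-- the prox point of `g*` with center `w/γ` has norm at most that of
any subgradient of `g` at `w`. -/
theorem prox_norm_le_subgradient
    (g : F → EReal) (hgp : ProperFn g) (hgc : ConvexFn g) (hgl : LowerSemicontinuous g)
    (w : F) (hsub : (subdiff g w).Nonempty) (γ : ℝ) (hγ : 0 < γ) (z : F)
    (hz : ∀ ζ : F, conj g z + ((-⟪z, w⟫ + γ / 2 * ‖z‖ ^ 2 : ℝ) : EReal)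
        ≤ conj g ζ + ((-⟪ζ, w⟫ + γ / 2 * ‖ζ‖ ^ 2 : ℝ) : EReal)) :
    ∀ zt ∈ subdiff g w, ‖z‖ ≤ ‖zt‖ := by
  intro zt hzt
  obtain ⟨r, hr⟩ : ∃ r : ℝ, g w = r :=
    ⟨(g w).toReal, (EReal.coe_toReal hzt.1 (hgp.1 w)).symm⟩
  have h := ((add_le_add_left (le_conj_of_eq_coe hr z) _).trans (hz zt)).trans
    (add_le_add_left (conj_le_of_mem_subdiff hr hzt) _)
  rw [← EReal.coe_add, ← EReal.coe_add, EReal.coe_le_coe_iff] at h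
  have hsq : γ / 2 * ‖z‖ ^ 2 ≤ γ / 2 * ‖zt‖ ^ 2 := by linarith
  exact (sq_le_sq₀ (norm_nonneg _) (norm_nonneg _)).mp (le_of_mul_le_mul_left hsq (half_pos hγ))

end FracPaper
end
end

section
/- Suppose Assumptions 1 and 2 hold. Fix γ > 0, ν > 0, δ := 2ν + L_{∇h} + 2‖A‖²/γ, β ∈ (0,2), and set c₁ := ν, c₂ := δ(2−β)/(2β), c₃ := γ/2. Let x^k ∈ S, u^k ∈ ℝⁿ, θ_k ∈ ℝ, z^k := prox_{g*,1/γ}(Ax^k/γ), and define y^{k+1} ∈ ∂f(Kx^k), x^{k+1} := the unique minimizer over S of x ↦ ⟨z^k, Ax⟩ − θ_k⟨Kx, y^{k+1}⟩ + ⟨∇h(x^k), x − x^k⟩ + (δ/2)‖x − u^k‖², u^{k+1} := (1−β)u^k + βx^{k+1}, and z^{k+1} := prox_{g*,1/γ}(Ax^{k+1}/γ). Then Ψ(x^{k+1},z^{k+1},u^{k+1};δ,γ) + θ_k f(Kx^k) − θ_k(⟨Kx^{k+1}, y^{k+1}⟩ − f*(y^{k+1})) ≤ Ψ(x^k,z^k,u^k;δ,γ)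 − c₁‖x^k − x^{k+1}‖² − c₂‖u^k − u^{k+1}‖² − c₃‖z^k − z^{k+1}‖². -/
open Set Filter Topology Metric

open scoped RealInnerProductSpace

noncomputable section

namespace FracPaper

variable {E : Type*} [NormedAddCommGroup E] [InnerProductSpace ℝ E] [FiniteDimensional ℝ E]
variable {F : Type*} [NormedAddCommGroup F] [InnerProductSpace ℝ F] [FiniteDimensional ℝ F]
variable {G : Type*} [NormedAddCommGroup G] [InnerProductSpace ℝ G] [FiniteDimensional ℝ G]

theorem nonneg_of_forall_linear_add_sq {p q : ℝ}
    (H : ∀ t : ℝ, 0 < t → t ≤ 1 → 0 ≤ t * p + t ^ 2 * q) : 0 ≤ p := by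
  have hlim : Tendsto (fun t : ℝ => p + t * q) (𝓝[>] 0) (𝓝 p) := by
    have h : Tendsto (fun t : ℝ => p + t * q) (𝓝 0) (𝓝 (p + 0 * q)) :=
      Continuous.tendsto (by fun_prop) 0
    simpa using h.mono_left nhdsWithin_le_nhds
  refine ge_of_tendsto hlim ?_
  filter_upwards [Ioc_mem_nhdsGT (zero_lt_one' ℝ)] with t ht
  have h := H t ht.1 ht.2
  exact nonneg_of_mul_nonneg_right (by linarith [h] : 0 ≤ t * (p + t * q)) ht.1

theorem le_add_inner_add_sq_of_gradient_lipschitz {H : Type*} [NormedAddCommGroup H]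
    [InnerProductSpace ℝ H] [CompleteSpace H] {S : Set H} (hS : Convex ℝ S)
    {h : H → ℝ} {h' : H → H} {L : ℝ} (hd : ∀ x ∈ S, HasGradientAt h (h' x) x)
    (hL : ∀ x ∈ S, ∀ y ∈ S, ‖h' x - h' y‖ ≤ L * ‖x - y‖) {x y : H} (hx : x ∈ S) (hy : y ∈ S) :
    h y ≤ h x + ⟪h' x, y - x⟫ + L / 2 * ‖y - x‖ ^ 2 := by
  set d := y - x with hdd
  have hmem : ∀ t ∈ Icc (0 : ℝ) 1, x + t • d ∈ S := fun t ht =>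
    hS.add_smul_sub_mem hx hy ht
  have hder : ∀ t ∈ Icc (0 : ℝ) 1, HasDerivAt
      (fun t : ℝ => h (x + t • d) - t * ⟪h' x, d⟫ - L / 2 * ‖d‖ ^ 2 * t ^ 2)
      (⟪h' (x + t • d), d⟫ - ⟪h' x, d⟫ - L * ‖d‖ ^ 2 * t) t := by
    intro t ht
    have h1 : HasDerivAt (fun t : ℝ => x + t • d) d t := by
      simpa using ((hasDerivAt_id t).smul_const d).const_add x
    have h2 : HasDerivAt (fun t : ℝ => h (x + t • d)) ⟪h' (x + t • d), d⟫ t := by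
      have h2 := (hd _ (hmem t ht)).hasFDerivAt.comp_hasDerivAt t h1
      rw [InnerProductSpace.toDual_apply_apply] at h2
      exact h2
    have h3 := (h2.sub ((hasDerivAt_id t).mul_const ⟪h' x, d⟫)).sub
      ((hasDerivAt_pow 2 t).const_mul (L / 2 * ‖d‖ ^ 2))
    refine h3.congr_deriv ?_
    norm_num
    ring
  have hanti : AntitoneOn
      (fun t : ℝ => h (x + t • d) - t * ⟪h' x, d⟫ - L / 2 * ‖d‖ ^ 2 * t ^ 2) (Icc 0 1) := by
    refine antitoneOn_of_deriv_nonpos (convex_Icc 0 1)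
      (fun t ht => (hder t ht).continuousAt.continuousWithinAt)
      (fun t ht => (hder t (interior_subset ht)).differentiableAt.differentiableWithinAt) ?_
    intro t ht
    have ht' := interior_subset ht
    rw [(hder t ht').deriv, ← inner_sub_left]
    have h1 := real_inner_le_norm (h' (x + t • d) - h' x) d
    have h2 := hL _ (hmem t ht') _ hx
    rw [add_sub_cancel_left, norm_smul, Real.norm_of_nonneg ht'.1] at h2
    nlinarith [mul_le_mul_of_nonneg_right h2 (norm_nonneg d)]
  have h01 := hanti (left_mem_Icc.2 zero_le_one) (right_mem_Icc.2 zero_le_one) zero_le_one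
  have hxy : x + d = y := by simp [hdd]
  simp [hxy] at h01
  linarith

theorem conj_ne_bot {H : Type*} [NormedAddCommGroup H] [InnerProductSpace ℝ H]
    {g : H → EReal} (hg : ∃ x, g x ≠ ⊤) (z : H) : conj g z ≠ ⊥ := by
  obtain ⟨x, hx⟩ := hg
  intro hbot
  have h : ((⟪z, x⟫ : ℝ) : EReal) - g x ≤ conj g z :=
    le_iSup (fun x => ((⟪z, x⟫ : ℝ) : EReal) - g x) x
  rw [hbot, le_bot_iff] at h
  induction hgx : g x with
  | bot => simp [hgx] at h
  | top => exact hx hgx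
  | coe r =>
    rw [hgx, ← EReal.coe_sub] at h
    exact EReal.coe_ne_bot _ h

/-- Equality case of the Fenchel–Young inequality. -/
theorem exists_coe_of_mem_subdiff {H : Type*} [NormedAddCommGroup H] [InnerProductSpace ℝ H]
    {g : H → EReal} (hg : ∀ x, g x ≠ ⊥) {v w : H}
    (hv : v ∈ subdiff g w) : ∃ r : ℝ, g w = r ∧ conj g v = ((⟪v, w⟫ - r : ℝ) : EReal) := by
  obtain ⟨htop, hsub⟩ := hv
  lift g w to ℝ using ⟨htop, hg w⟩ with r hr
  refine ⟨r, rfl, le_antisymm (iSup_le fun y => ?_) ?_⟩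
  · have hy := hsub y
    induction hgy : g y with
    | bot => exact absurd hgy (hg y)
    | top => simp
    | coe s =>
      rw [hgy] at hy
      norm_cast at hy ⊢
      rw [inner_sub_right] at hy
      linarith
  · refine le_trans ?_ (le_iSup (fun x => ((⟪v, x⟫ : ℝ) : EReal) - g x) w)
    simp only [← hr]
    norm_cast

theorem conj_segment_le {H : Type*} [NormedAddCommGroup H] [InnerProductSpace ℝ H]
    {g : H → EReal} (hg : ∀ x, g x ≠ ⊥) {z w : H} {a b t : ℝ}
    (hz : conj g z = a) (hw : conj g w = b) (ht0 : 0 ≤ t) (ht1 : t ≤ 1) :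
    conj g (z + t • (w - z)) ≤ ((a + t * (b - a) : ℝ) : EReal) := by
  refine iSup_le fun x => ?_
  have h1 : ((⟪z, x⟫ : ℝ) : EReal) - g x ≤ a :=
    hz ▸ le_iSup (fun x => ((⟪z, x⟫ : ℝ) : EReal) - g x) x
  have h2 : ((⟪w, x⟫ : ℝ) : EReal) - g x ≤ b :=
    hw ▸ le_iSup (fun x => ((⟪w, x⟫ : ℝ) : EReal) - g x) x
  induction hgx : g x with
  | bot => exact absurd hgx (hg x)
  | top => simp
  | coe r =>
    rw [hgx] at h1 h2
    norm_cast at h1 h2 ⊢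
    rw [inner_add_left, real_inner_smul_left, inner_sub_left]
    nlinarith [mul_le_mul_of_nonneg_left h2 ht0,
      mul_le_mul_of_nonneg_left h1 (sub_nonneg.2 ht1)]

/-- Quadratic growth at a minimizer of `conj g + γ / 2 * ‖·‖ ^ 2 - ⟪·, p⟫`. -/
theorem conj_prox_growth {H : Type*} [NormedAddCommGroup H] [InnerProductSpace ℝ H]
    {g : H → EReal} (hg : ∀ x, g x ≠ ⊥) {γ : ℝ} {p z w : H} {a b : ℝ}
    (hz : conj g z = a) (hw : conj g w = b)
    (hmin : ∀ ζ : H, conj g z + ((-⟪z, p⟫ + γ / 2 * ‖z‖ ^ 2 : ℝ) : EReal)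
        ≤ conj g ζ + ((-⟪ζ, p⟫ + γ / 2 * ‖ζ‖ ^ 2 : ℝ) : EReal)) :
    a - ⟪z, p⟫ + γ / 2 * ‖z‖ ^ 2 + γ / 2 * ‖w - z‖ ^ 2 ≤ b - ⟪w, p⟫ + γ / 2 * ‖w‖ ^ 2 := by
  have hfirst : 0 ≤ (b - a) - ⟪w - z, p⟫ + γ * ⟪z, w - z⟫ := by
    refine nonneg_of_forall_linear_add_sq (q := γ / 2 * ‖w - z‖ ^ 2) fun t ht0 ht1 => ?_
    have h := (hmin (z + t • (w - z))).trans
      (add_le_add_left (conj_segment_le hg hz hw ht0.le ht1) _)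
    rw [hz] at h
    norm_cast at h
    rw [norm_add_sq_real, inner_add_left, real_inner_smul_left, real_inner_smul_right, norm_smul,
      mul_pow, Real.norm_eq_abs, sq_abs] at h
    nlinarith [h]
  have h := norm_add_sq_real z (w - z)
  rw [add_sub_cancel] at h
  rw [inner_sub_left] at hfirst
  rw [h]
  linarith

/-- Quadratic growth at a minimizer over a convex set of an affine function plus
`δ / 2 * ‖· - u‖ ^ 2`. -/
theorem affine_prox_growth {H : Type*} [NormedAddCommGroup H] [InnerProductSpace ℝ H]
    {S : Set H} (hS : Convex ℝ S) {l : H → ℝ} {δ : ℝ} {u x w : H}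
    (hl : ∀ t : ℝ, l (x + t • (w - x)) = l x + t * (l w - l x)) (hx : x ∈ S) (hw : w ∈ S)
    (hmin : ∀ v ∈ S, l x + δ / 2 * ‖x - u‖ ^ 2 ≤ l v + δ / 2 * ‖v - u‖ ^ 2) :
    l x + δ / 2 * ‖x - u‖ ^ 2 + δ / 2 * ‖w - x‖ ^ 2 ≤ l w + δ / 2 * ‖w - u‖ ^ 2 := by
  have hfirst : 0 ≤ (l w - l x) + δ * ⟪x - u, w - x⟫ := by
    refine nonneg_of_forall_linear_add_sq (q := δ / 2 * ‖w - x‖ ^ 2) fun t ht0 ht1 => ?_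
    have h := hmin _ (hS.add_smul_sub_mem hx hw ⟨ht0.le, ht1⟩)
    rw [hl, add_sub_right_comm, norm_add_sq_real, real_inner_smul_right, norm_smul,
      mul_pow, Real.norm_eq_abs, sq_abs] at h
    nlinarith [h]
  have h := norm_add_sq_real (x - u) (w - x)
  rw [show x - u + (w - x) = w - u by abel] at h
  rw [h]
  linarith

/-- one-step descent estimate (Theorem 5.3 (i)). -/
theorem one_step_descent
    (S : Set E) (g : F → EReal) (h : E → ℝ) (h' : E → E) (Lh : ℝ)
    (f : G → EReal) (A : E →L[ℝ] F) (K : E →L[ℝ] G)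
    (hA1 : Assumption1 S g h h' Lh f A K) (hA2 : Assumption2 S g A)
    (γ ν β δ c₁ c₂ c₃ : ℝ) (hγ : 0 < γ) (hν : 0 < ν) (hβ : β ∈ Ioo (0 : ℝ) 2)
    (hδ : δ = 2 * ν + Lh + 2 * ‖A‖ ^ 2 / γ)
    (hc₁ : c₁ = ν) (hc₂ : c₂ = δ * (2 - β) / (2 * β)) (hc₃ : c₃ = γ / 2)
    (xk uk : E) (θk : ℝ) (zk : F) (yk1 : G) (xk1 uk1 : E) (zk1 : F)
    (hxkS : xk ∈ S)
    (hzk : ∀ ζ : F, conj g zk + ((-⟪zk, A xk⟫ + γ / 2 * ‖zk‖ ^ 2 : ℝ) : EReal)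
        ≤ conj g ζ + ((-⟪ζ, A xk⟫ + γ / 2 * ‖ζ‖ ^ 2 : ℝ) : EReal))
    (hyk1 : yk1 ∈ subdiff f (K xk))
    (hxk1S : xk1 ∈ S)
    (hxk1 : ∀ w ∈ S,
        ⟪zk, A xk1⟫ - θk * ⟪K xk1, yk1⟫ + ⟪h' xk, xk1 - xk⟫ + δ / 2 * ‖xk1 - uk‖ ^ 2
          ≤ ⟪zk, A w⟫ - θk * ⟪K w, yk1⟫ + ⟪h' xk, w - xk⟫ + δ / 2 * ‖w - uk‖ ^ 2)
    (huk1 : uk1 = (1 - β) • uk + β • xk1)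
    (hzk1 : ∀ ζ : F, conj g zk1 + ((-⟪zk1, A xk1⟫ + γ / 2 * ‖zk1‖ ^ 2 : ℝ) : EReal)
        ≤ conj g ζ + ((-⟪ζ, A xk1⟫ + γ / 2 * ‖ζ‖ ^ 2 : ℝ) : EReal)) :
    psi S g h A δ γ xk1 zk1 uk1 + (θk : EReal) * f (K xk)
        - (θk : EReal) * (((⟪K xk1, yk1⟫ : ℝ) : EReal) - conj f yk1)
      ≤ psi S g h A δ γ xk zk uk
        - ((c₁ * ‖xk - xk1‖ ^ 2 + c₂ * ‖uk - uk1‖ ^ 2 + c₃ * ‖zk - zk1‖ ^ 2 : ℝ) : EReal) := by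
  obtain ⟨-, hSc, -, ⟨hgbot, hgtop⟩, -, -, ⟨O, -, hSO, hgrad, hLip⟩, ⟨hfbot, -⟩, -⟩ := hA1
  have hfinite : ∀ p ∈ S, ∀ z : F, (∀ ζ : F,
      conj g z + ((-⟪z, A p⟫ + γ / 2 * ‖z‖ ^ 2 : ℝ) : EReal)
        ≤ conj g ζ + ((-⟪ζ, A p⟫ + γ / 2 * ‖ζ‖ ^ 2 : ℝ) : EReal)) →
      ∃ a : ℝ, conj g z = a := by
    intro p hp z hz
    obtain ⟨v, hv⟩ := hA2.1 p hp
    obtain ⟨r, -, hvr⟩ := exists_coe_of_mem_subdiff hgbot hv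
    have h := hz v
    rw [hvr] at h
    have htop : conj g z ≠ ⊤ := by
      intro htop
      rw [htop, EReal.top_add_coe, top_le_iff, ← EReal.coe_add] at h
      exact EReal.coe_ne_top _ h
    exact ⟨_, (EReal.coe_toReal htop (conj_ne_bot hgtop z)).symm⟩
  obtain ⟨a, ha⟩ := hfinite xk hxkS zk hzk
  obtain ⟨b, hb⟩ := hfinite xk1 hxk1S zk1 hzk1
  obtain ⟨r, hfr, hfc⟩ := exists_coe_of_mem_subdiff hfbot hyk1
  have hz0 := conj_prox_growth hgbot ha hb hzk
  have hz1 := conj_prox_growth hgbot hb ha hzk1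
  have hdesc := le_add_inner_add_sq_of_gradient_lipschitz hSc (fun x hx => hgrad x (hSO hx))
    (fun x hx y hy => hLip x (hSO hx) y (hSO hy)) hxkS hxk1S
  have hx := affine_prox_growth (l := fun w => ⟪zk, A w⟫ - θk * ⟪K w, yk1⟫ + ⟪h' xk, w - xk⟫)
    hSc (fun t => by
      simp only [map_add, map_smul, map_sub, inner_add_right, inner_add_left, inner_sub_right,
        inner_sub_left, real_inner_smul_left, real_inner_smul_right]
      ring) hxk1S hxkS hxk1
  simp only [sub_self, inner_zero_right, add_zero] at hx
  have hcross : ⟪zk1 - zk, A (xk1 - xk)⟫ ≤ ‖A‖ ^ 2 / γ * ‖xk1 - xk‖ ^ 2 := by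
    have hle : ⟪zk1 - zk, A (xk1 - xk)⟫ ≤ ‖zk1 - zk‖ * (‖A‖ * ‖xk1 - xk‖) :=
      (real_inner_le_norm _ _).trans
        (mul_le_mul_of_nonneg_left (A.le_opNorm _) (norm_nonneg _))
    have hmono : γ * ‖zk1 - zk‖ ^ 2 ≤ ⟪zk1 - zk, A (xk1 - xk)⟫ := by
      rw [norm_sub_rev zk zk1] at hz1
      rw [map_sub, inner_sub_left, inner_sub_right, inner_sub_right]
      linarith
    rw [div_mul_eq_mul_div, le_div_iff₀ hγ]
    nlinarith [sq_nonneg (γ * ‖zk1 - zk‖ - ‖A‖ * ‖xk1 - xk‖)]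
  have hu1 : ‖xk1 - uk1‖ ^ 2 = (1 - β) ^ 2 * ‖xk1 - uk‖ ^ 2 := by
    rw [huk1, show xk1 - ((1 - β) • uk + β • xk1) = (1 - β) • (xk1 - uk) by module,
      norm_smul, mul_pow, Real.norm_eq_abs, sq_abs]
  have hu2 : c₂ * ‖uk - uk1‖ ^ 2 = δ * (2 - β) * β / 2 * ‖xk1 - uk‖ ^ 2 := by
    have hβ0 : β ≠ 0 := hβ.1.ne'
    rw [huk1, show uk - ((1 - β) • uk + β • xk1) = (-β) • (xk1 - uk) by module,
      norm_smul, mul_pow, Real.norm_eq_abs, sq_abs, hc₂]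
    field_simp
  have hδ' : δ / 2 * ‖xk1 - xk‖ ^ 2
      = ν * ‖xk1 - xk‖ ^ 2 + Lh / 2 * ‖xk1 - xk‖ ^ 2 + ‖A‖ ^ 2 / γ * ‖xk1 - xk‖ ^ 2 := by
    rw [hδ]
    ring
  simp only [psi, indicatorFn, hxkS, hxk1S, if_true, add_zero, ha, hb, hfr, hfc]
  norm_cast
  rw [hu2, hu1, hc₁, hc₃, norm_sub_rev zk zk1, norm_sub_rev xk xk1]
  rw [norm_sub_rev xk xk1] at hx
  rw [map_sub, inner_sub_left, inner_sub_right, inner_sub_right] at hcross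
  rw [real_inner_comm (K xk) yk1]
  linarith


end FracPaper
end
end
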